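/- Fix q ∈ (0,1/2) and a > 0 with a·c₀ ≥ 2. There exist constants N₀ and C > 0, independent of ε, such that for every ε ∈ (0,1] with aε < q and every integer N ≥ N₀ the following holds. Let X_0 < … < X_N be the coarse Vulanović mesh, let y^H be the unique solution of the nonlinear discrete scheme on this coarse mesh, and let ŷ : [0,1] → ℝ be its continuous piecewise linear interpolant. Let n = N², let x_0 < … < x_n be the fine Vulanović mesh with the same parameters a, q, and let y^h be the unique solution of the linear fine-mesh scheme −ε² y_{x̄x̂,i} + f_u(x_i, ŷ(x_i)) y_i = f_u(x_i, ŷ(x_i)) ŷ(x_i) − f(x_i, ŷ(x_i)), i = 1,…,n−1, y_0 = y_n = 0. Then the continuous piecewise linear interpolant u^I_{h,H} of y^h on the fine mesh satisfies max_{x∈[0,1]} |u^I_{h,H}(x) − u(x)| ≤ C N^{−4}, where u is the solution of the continuous problem. -/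

import Mathlib

open Set Real

noncomputable section

/-- first partial derivative of `f(x,u)` with respect to `u` -/
def pderiv1 (f : ℝ → ℝ → ℝ) (x y : ℝ) : ℝ := deriv (fun z => f x z) y

/-- second partial derivative of `f(x,u)` with respect to `u` -/
def pderiv2 (f : ℝ → ℝ → ℝ) (x y : ℝ) : ℝ :=
  deriv (fun z => deriv (fun w => f x w) z) y

/-- `f` is four times continuously differentiable on `[0,1] × ℝ`. -/
def SmoothF (f : ℝ → ℝ → ℝ) : Prop :=
  ContDiffOn ℝ 4 (fun p : ℝ × ℝ => f p.1 p.2) ((Icc (0:ℝ) 1) ×ˢ (univ : Set ℝ))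

/-- the stability condition `f_u(x,u) ≥ c₀² > 0` on `[0,1] × ℝ` -/
def LowerF (f : ℝ → ℝ → ℝ) (c₀ : ℝ) : Prop :=
  ∀ x ∈ Icc (0:ℝ) 1, ∀ y : ℝ, c₀ ^ 2 ≤ pderiv1 f x y

/-- `u` is a C⁴-solution of the semilinear BVP `-ε²u'' + f(x,u) = 0`, `u(0)=u(1)=0`. -/
def IsSolution (f : ℝ → ℝ → ℝ) (ε : ℝ) (u : ℝ → ℝ) : Prop :=
  ContDiffOn ℝ 4 u (Icc (0:ℝ) 1) ∧
  (∀ x ∈ Ioo (0:ℝ) 1,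
    -ε ^ 2 * iteratedDerivWithin 2 u (Icc (0:ℝ) 1) x + f x (u x) = 0) ∧
  u 0 = 0 ∧ u 1 = 0

/-- the constant `l = c₀⁻² · max_{[0,1]} |f(x,0)|` -/
def lconst (f : ℝ → ℝ → ℝ) (c₀ : ℝ) : ℝ :=
  c₀ ^ (-2 : ℤ) * sSup ((fun x => |f x 0|) '' Icc (0:ℝ) 1)

/-- the constant `θ = max { |f_uu(x,ξ)| : x ∈ [0,1], |ξ| ≤ l + 2ρ }` -/
def thconst (f : ℝ → ℝ → ℝ) (c₀ ρ : ℝ) : ℝ :=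
  sSup ((fun p : ℝ × ℝ => |pderiv2 f p.1 p.2|) ''
    ((Icc (0:ℝ) 1) ×ˢ (Icc (-(lconst f c₀ + 2*ρ)) (lconst f c₀ + 2*ρ))))

/-- discrete second difference `y_{x̄x̂,i}` on a nonuniform mesh `x` (for `1 ≤ i`),
using `ℏ_i = (h_i + h_{i+1})/2 = (x_{i+1} - x_{i-1})/2`. -/
def ddiff (x y : ℕ → ℝ) (i : ℕ) : ℝ :=
  2 / (x (i+1) - x (i-1)) *
    ((y (i+1) - y i) / (x (i+1) - x i) - (y i - y (i-1)) / (x i - x (i-1)))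

/-- Shishkin mesh generating function with transition parameter
`α = min(1/4, 2γ₀⁻¹ ε ln n)`. -/
def shishkinLam (γ₀ ε : ℝ) (n : ℕ) (t : ℝ) : ℝ :=
  let α := min (1/4) (2 * γ₀⁻¹ * ε * Real.log n)
  if t ≤ 1/4 then 4*α*t
  else if t ≤ 1/2 then α + 2*(1-2*α)*(t-1/4)
  else 1 - (if 1-t ≤ 1/4 then 4*α*(1-t) else α + 2*(1-2*α)*((1-t)-1/4))

/-- Shishkin mesh nodes `x_i = λ(i/n)` -/
def shishkinMesh (γ₀ ε : ℝ) (n i : ℕ) : ℝ := shishkinLam γ₀ ε n ((i:ℝ)/(n:ℝ))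

def bakhPhi (a ε q t : ℝ) : ℝ := a*ε*Real.log (q/(q-t))

/-- derivative of `bakhPhi` -/
def bakhPhi' (a ε q t : ℝ) : ℝ := a*ε/(q-t)

/-- `α ∈ (0,q)` is the abscissa of the contact point of the tangent line from
`(1/2,1/2)` to `φ`, i.e. `φ(α) + φ'(α)(1/2 - α) = 1/2`. -/
def IsBakhAlpha (a ε q α : ℝ) : Prop :=
  α ∈ Ioo 0 q ∧ bakhPhi a ε q α + bakhPhi' a ε q α * (1/2 - α) = 1/2

/-- Bakhvalov mesh generating function -/
def bakhLam (a ε q α t : ℝ) : ℝ :=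
  if t ≤ α then bakhPhi a ε q t
  else if t ≤ 1/2 then bakhPhi a ε q α + bakhPhi' a ε q α * (t-α)
  else 1 - (if 1-t ≤ α then bakhPhi a ε q (1-t)
            else bakhPhi a ε q α + bakhPhi' a ε q α * ((1-t)-α))

/-- Bakhvalov mesh nodes `x_i = λ(i/n)` -/
def bakhMesh (a ε q α : ℝ) (n i : ℕ) : ℝ := bakhLam a ε q α ((i:ℝ)/(n:ℝ))

def vulAlpha (a ε q : ℝ) : ℝ :=
  (q - Real.sqrt (ε*a*q*(1-2*q+2*ε*a)))/(1+2*ε*a)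

def vulMu (a ε q t : ℝ) : ℝ := a*ε*t/(q-t)

/-- derivative of `vulMu` -/
def vulMu' (a ε q t : ℝ) : ℝ := a*ε*q/(q-t)^2

/-- Vulanović mesh generating function -/
def vulLam (a ε q t : ℝ) : ℝ :=
  let α := vulAlpha a ε q
  if t ≤ α then vulMu a ε q t
  else if t ≤ 1/2 then vulMu a ε q α + vulMu' a ε q α * (t-α)
  else 1 - (if 1-t ≤ α then vulMu a ε q (1-t)
            else vulMu a ε q α + vulMu' a ε q α * ((1-t)-α))

/-- Vulanović mesh nodes `x_i = λ(i/n)` -/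
def vulMesh (a ε q : ℝ) (n i : ℕ) : ℝ := vulLam a ε q ((i:ℝ)/(n:ℝ))

/-- the three-point discrete scheme for the linear problem
`-ε² y_{x̄x̂,i} + b(x_i) y_i = g(x_i)`, `y_0 = y_n = 0` -/
def LinScheme (bc gc : ℝ → ℝ) (ε : ℝ) (x : ℕ → ℝ) (n : ℕ) (y : ℕ → ℝ) : Prop :=
  (∀ i : ℕ, 1 ≤ i → i < n →
    -ε ^ 2 * ddiff x y i + bc (x i) * y i = gc (x i)) ∧
  y 0 = 0 ∧ y n = 0

/-- the nonlinear discrete scheme `-ε² y_{x̄x̂,i} + f(x_i, y_i) = 0`, `y_0 = y_n = 0` -/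
def NonlinScheme (f : ℝ → ℝ → ℝ) (ε : ℝ) (x : ℕ → ℝ) (n : ℕ) (y : ℕ → ℝ) : Prop :=
  (∀ i : ℕ, 1 ≤ i → i < n → -ε ^ 2 * ddiff x y i + f (x i) (y i) = 0) ∧
  y 0 = 0 ∧ y n = 0

/-- `u` is a C²-solution of the continuous linear problem
`-ε²u'' + b(x)u = g(x)`, `u(0)=u(1)=0`. -/
def IsLinSolution (bc gc : ℝ → ℝ) (ε : ℝ) (u : ℝ → ℝ) : Prop :=
  ContDiffOn ℝ 2 u (Icc (0:ℝ) 1) ∧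
  (∀ x ∈ Ioo (0:ℝ) 1,
    -ε ^ 2 * iteratedDerivWithin 2 u (Icc (0:ℝ) 1) x + bc x * u x = gc x) ∧
  u 0 = 0 ∧ u 1 = 0

/-- `b(x,ε)` is three times continuously differentiable in `x` on `[0,1]`,
with these derivatives bounded uniformly in `ε ∈ [0,1]`. -/
def UnifC3 (b : ℝ → ℝ → ℝ) : Prop :=
  ∃ M : ℝ, ∀ ε ∈ Icc (0:ℝ) 1,
    ContDiffOn ℝ 3 (fun x => b x ε) (Icc (0:ℝ) 1) ∧
    ∀ j : ℕ, j ≤ 3 → ∀ x ∈ Icc (0:ℝ) 1,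
      |iteratedDerivWithin j (fun x => b x ε) (Icc (0:ℝ) 1) x| ≤ M

/-- `w` is the continuous piecewise-linear interpolant of mesh data `y`
on the mesh `x_0 < … < x_n`. -/
def IsLinInterp (x : ℕ → ℝ) (n : ℕ) (y : ℕ → ℝ) (w : ℝ → ℝ) : Prop :=
  (∀ i ≤ n, w (x i) = y i) ∧
  ∀ i < n, ∀ t ∈ Icc (x i) (x (i+1)),
    w t = y i + (y (i+1) - y i) * (t - x i) / (x (i+1) - x i)

/-- properties of the initial guess `u⁰`: of class C³, within `ρ` of the
solution `u`, and satisfying ε-uniform bounds of layer type for `j = 0, 1`. -/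
def InitGuess (c₀ ε C₀ ρ : ℝ) (u u0 : ℝ → ℝ) : Prop :=
  ContDiffOn ℝ 3 u0 (Icc (0:ℝ) 1) ∧
  (∀ x ∈ Icc (0:ℝ) 1, |u0 x - u x| ≤ ρ) ∧
  (∀ x ∈ Icc (0:ℝ) 1, |u0 x| ≤ C₀) ∧
  (∀ x ∈ Icc (0:ℝ) 1, |derivWithin u0 (Icc (0:ℝ) 1) x| ≤
    C₀ * (1 + ε⁻¹ * (Real.exp (-c₀*x/ε) + Real.exp (-c₀*(1-x)/ε))))

/-- the discrete Newton (quasilinearization) iterates on the mesh `x`: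
`y⁰_i = u⁰(x_i)` and `y^{m+1}` solves the quasilinearized discrete problem. -/
def NewtonIter (f : ℝ → ℝ → ℝ) (ε : ℝ) (x : ℕ → ℝ) (n : ℕ) (u0 : ℝ → ℝ)
    (Y : ℕ → ℕ → ℝ) : Prop :=
  (∀ i ≤ n, Y 0 i = u0 (x i)) ∧
  ∀ m : ℕ,
    (∀ i : ℕ, 1 ≤ i → i < n →
      -ε ^ 2 * ddiff x (Y (m+1)) i + pderiv1 f (x i) (Y m i) * Y (m+1) i
        = -f (x i) (Y m i) + pderiv1 f (x i) (Y m i) * Y m i) ∧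
    Y (m+1) 0 = 0 ∧ Y (m+1) n = 0


def SS : Set (ℝ × ℝ) := (Icc (0:ℝ) 1) ×ˢ (univ : Set ℝ)

def EE (m ε x : ℝ) : ℝ := Real.exp (-(m*x/ε)) + Real.exp (-(m*(1-x)/ε))

lemma uniqueDiffSS : UniqueDiffOn ℝ SS :=
  (uniqueDiffOn_Icc (by norm_num)).prod uniqueDiffOn_univ

lemma chainF (φ : ℝ → ℝ → ℝ) (k : ℕ)
    (h : ContDiffOn ℝ ((k + 1 : ℕ) : WithTop ℕ∞) (fun p : ℝ × ℝ => φ p.1 p.2) SS) :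
    ∃ φx φu : ℝ → ℝ → ℝ,
      ContDiffOn ℝ (k : WithTop ℕ∞) (fun p : ℝ × ℝ => φx p.1 p.2) SS ∧
      ContDiffOn ℝ (k : WithTop ℕ∞) (fun p : ℝ × ℝ => φu p.1 p.2) SS ∧
      (∀ x ∈ Icc (0:ℝ) 1, ∀ (u : ℝ → ℝ) (u' : ℝ), HasDerivWithinAt u u' (Icc 0 1) x →
        HasDerivWithinAt (fun t => φ t (u t)) (φx x (u x) + φu x (u x) * u') (Icc 0 1) x) ∧
      (∀ x ∈ Icc (0:ℝ) 1, ∀ y, HasDerivAt (φ x) (φu x y) y) := by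
  set F : ℝ × ℝ → ℝ := fun p => φ p.1 p.2 with hF
  have hd : ∀ p ∈ SS, HasFDerivWithinAt F (fderivWithin ℝ F SS p) SS p := fun p hp =>
    ((h.differentiableOn (by simp)) p hp).hasFDerivWithinAt
  have hc : ContDiffOn ℝ (k : WithTop ℕ∞) (fderivWithin ℝ F SS) SS :=
    h.fderivWithin uniqueDiffSS (by push_cast; exact le_rfl)
  refine ⟨fun x y => fderivWithin ℝ F SS (x, y) (1, 0), fun x y => fderivWithin ℝ F SS (x, y) (0, 1),
    ?_, ?_, ?_, ?_⟩
  · exact hc.clm_apply contDiffOn_const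
  · exact hc.clm_apply contDiffOn_const
  · intro x hx u u' hu
    have h1 : HasDerivWithinAt (fun t => (t, u t)) ((1 : ℝ), u') (Icc 0 1) x :=
      (hasDerivWithinAt_id x _).prodMk hu
    have h2 := (hd (x, u x) ⟨hx, mem_univ _⟩).comp_hasDerivWithinAt x h1
      (show MapsTo (fun t : ℝ => (t, u t)) (Icc 0 1) SS from fun t ht => ⟨ht, mem_univ _⟩)
    have h3 : fderivWithin ℝ F SS (x, u x) ((1 : ℝ), u') =
        fderivWithin ℝ F SS (x, u x) (1, 0) + fderivWithin ℝ F SS (x, u x) (0, 1) * u' := by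
      have : ((1 : ℝ), u') = (1, 0) + u' • ((0 : ℝ), (1 : ℝ)) := by simp
      rw [this, map_add, map_smul, smul_eq_mul]; ring
    rw [h3] at h2
    exact h2
  · intro x hx y
    have h1 : HasDerivAt (fun t : ℝ => (x, t)) ((0 : ℝ), (1 : ℝ)) y :=
      (hasDerivAt_const y x).prodMk (hasDerivAt_id y)
    have h2 := (hd (x, y) ⟨hx, mem_univ _⟩).comp_hasDerivWithinAt y (h1.hasDerivWithinAt (s := univ))
      (show MapsTo (fun t : ℝ => (x, t)) univ SS from fun t ht => ⟨hx, mem_univ _⟩)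
    rw [hasDerivWithinAt_univ] at h2
    exact h2

lemma bddF (φ : ℝ → ℝ → ℝ) (h : ContinuousOn (fun p : ℝ × ℝ => φ p.1 p.2) SS) (L : ℝ) :
    ∃ M : ℝ, 0 < M ∧ ∀ x ∈ Icc (0:ℝ) 1, ∀ y, |y| ≤ L → |φ x y| ≤ M := by
  have hK : IsCompact ((Icc (0:ℝ) 1) ×ˢ (Icc (-L) L)) := isCompact_Icc.prod isCompact_Icc
  obtain ⟨M, hM⟩ := hK.exists_bound_of_continuousOn
    (h.mono (prod_mono le_rfl (subset_univ _)))
  refine ⟨max M 1, by positivity, fun x hx y hy => ?_⟩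
  have := hM (x, y) ⟨hx, abs_le.1 hy⟩
  exact this.trans (le_max_left _ _)

/-- maximum principle -/
lemma maxPr (z z1 z2 : ℝ → ℝ)
    (h1 : ∀ x ∈ Icc (0:ℝ) 1, HasDerivWithinAt z (z1 x) (Icc 0 1) x)
    (h2 : ∀ x ∈ Icc (0:ℝ) 1, HasDerivWithinAt z1 (z2 x) (Icc 0 1) x)
    (h0 : z 0 ≤ 0) (h0' : z 1 ≤ 0)
    (hp : ∀ x ∈ Icc (0:ℝ) 1, 0 < z x → 0 < z2 x) : ∀ x ∈ Icc (0:ℝ) 1, z x ≤ 0 := by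
  have hcont : ContinuousOn z (Icc 0 1) := fun x hx => (h1 x hx).continuousWithinAt
  obtain ⟨x0, hx0, hmax⟩ := isCompact_Icc.exists_isMaxOn (nonempty_Icc.2 zero_le_one) hcont
  intro x hx
  by_contra hneg
  push Not at hneg
  have hz0 : 0 < z x0 := hneg.trans_le (hmax hx)
  have hxi : x0 ∈ Ioo (0:ℝ) 1 := by
    refine ⟨lt_of_le_of_ne hx0.1 ?_, lt_of_le_of_ne hx0.2 ?_⟩
    · rintro rfl; linarith
    · rintro rfl; linarith
  have hI : ∀ y ∈ Ioo (0:ℝ) 1, Icc (0:ℝ) 1 ∈ nhds y := fun y hy => Icc_mem_nhds hy.1 hy.2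
  have hd1 : ∀ y ∈ Ioo (0:ℝ) 1, HasDerivAt z (z1 y) y := fun y hy =>
    (h1 y (Ioo_subset_Icc_self hy)).hasDerivAt (hI y hy)
  have hd2 : ∀ y ∈ Ioo (0:ℝ) 1, HasDerivAt z1 (z2 y) y := fun y hy =>
    (h2 y (Ioo_subset_Icc_self hy)).hasDerivAt (hI y hy)
  have hev : ∀ᶠ y in nhds x0, y ∈ Ioo (0:ℝ) 1 := Ioo_mem_nhds hxi.1 hxi.2
  have hderiv : deriv z =ᶠ[nhds x0] z1 := hev.mono fun y hy => (hd1 y hy).deriv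
  have hlm : IsLocalMax z x0 := (hmax.isLocalMax (hI x0 hxi))
  have hz1 : z1 x0 = 0 := by
    have := hlm.deriv_eq_zero
    rwa [(hd1 x0 hxi).deriv] at this
  have hdd : deriv (deriv z) x0 = z2 x0 := by
    rw [hderiv.deriv_eq]; exact (hd2 x0 hxi).deriv
  have hlmin : IsLocalMin z x0 :=
    isLocalMin_of_deriv_deriv_pos (by rw [hdd]; exact hp x0 hx0 hz0) hlm.deriv_eq_zero
      (hd1 x0 hxi).continuousAt
  have hconst : z =ᶠ[nhds x0] fun _ => z x0 := by
    filter_upwards [hlm, hlmin] with y hy1 hy2 using le_antisymm hy1 hy2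
  have : deriv z =ᶠ[nhds x0] fun _ => 0 := by
    have := hconst.deriv
    simpa using this
  have h5 : deriv (deriv z) x0 = 0 := by rw [this.deriv_eq]; simp
  have := hp x0 hx0 hz0
  rw [hdd] at h5
  linarith

/-- mean value inequality -/
lemma mvi (p p1 : ℝ → ℝ) (s t B : ℝ) (_hst : s ≤ t)
    (hd : ∀ x ∈ Icc s t, HasDerivWithinAt p (p1 x) (Icc s t) x)
    (hb : ∀ x ∈ Icc s t, |p1 x| ≤ B) {x y : ℝ} (hx : x ∈ Icc s t) (hy : y ∈ Icc s t) :
    |p y - p x| ≤ B * |y - x| :=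
  (convex_Icc s t).norm_image_sub_le_of_norm_hasDerivWithin_le hd hb hx hy

lemma mvt (p p1 : ℝ → ℝ) (s t : ℝ) (hst : s < t)
    (hd : ∀ x ∈ Icc s t, HasDerivWithinAt p (p1 x) (Icc s t) x) :
    ∃ ξ ∈ Ioo s t, p t - p s = p1 ξ * (t - s) := by
  obtain ⟨ξ, hξ, h⟩ := exists_hasDerivAt_eq_slope p p1 hst
    (fun x hx => (hd x hx).continuousWithinAt)
    (fun x hx => (hd x (Ioo_subset_Icc_self hx)).hasDerivAt (Icc_mem_nhds hx.1 hx.2))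
  refine ⟨ξ, hξ, ?_⟩
  rw [h, div_mul_cancel₀]
  linarith

lemma interp1 (p p1 p2 : ℝ → ℝ)
    (h1 : ∀ x ∈ Icc (0:ℝ) 1, HasDerivWithinAt p (p1 x) (Icc 0 1) x)
    (h2 : ∀ x ∈ Icc (0:ℝ) 1, HasDerivWithinAt p1 (p2 x) (Icc 0 1) x)
    (ε : ℝ) (hε : 0 < ε) (hε1 : ε ≤ 1) (x : ℝ) (hx : x ∈ Icc (0:ℝ) 1) (P Q : ℝ)
    (hP : ∀ y ∈ Icc (0:ℝ) 1, |y - x| ≤ ε / 2 → |p y| ≤ P)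
    (hQ : ∀ y ∈ Icc (0:ℝ) 1, |y - x| ≤ ε / 2 → |p2 y| ≤ Q) :
    |p1 x| ≤ 4 * P / ε + Q * ε := by
  obtain ⟨s, t, hst, hsub, hx', hlen⟩ : ∃ s t : ℝ, t - s = ε / 2 ∧ Icc s t ⊆ Icc 0 1 ∧
      x ∈ Icc s t ∧ ∀ y ∈ Icc s t, |y - x| ≤ ε / 2 := by
    rcases le_total x (1/2) with h | h
    · refine ⟨x, x + ε/2, by ring, Icc_subset_Icc hx.1 (by linarith), ⟨le_rfl, by linarith⟩, ?_⟩
      rintro y ⟨h3, h4⟩; rw [abs_le]; constructor <;> linarith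
    · refine ⟨x - ε/2, x, by ring, Icc_subset_Icc (by linarith) hx.2, ⟨by linarith, le_rfl⟩, ?_⟩
      rintro y ⟨h3, h4⟩; rw [abs_le]; constructor <;> linarith
  have hlt : s < t := by linarith
  obtain ⟨ξ, hξ, hm⟩ := mvt p p1 s t hlt (fun y hy => (h1 y (hsub hy)).mono hsub)
  have hξ' := Ioo_subset_Icc_self hξ
  have hs : s ∈ Icc s t := ⟨le_rfl, hlt.le⟩
  have ht : t ∈ Icc s t := ⟨hlt.le, le_rfl⟩
  have e1 : |p1 ξ| ≤ 4 * P / ε := by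
    have a1 := hP s (hsub hs) (hlen s hs)
    have a2 := hP t (hsub ht) (hlen t ht)
    rw [hst] at hm
    have : |p1 ξ * (ε/2)| ≤ 2 * P := by
      rw [← hm]; exact (abs_sub _ _).trans (by linarith)
    rw [abs_mul, abs_of_pos (by positivity : (0:ℝ) < ε/2)] at this
    rw [le_div_iff₀ hε]; linarith
  have e2 := mvi p1 p2 s t Q hlt.le (fun y hy => (h2 y (hsub hy)).mono hsub)
    (fun y hy => hQ y (hsub hy) (hlen y hy)) hξ' hx'
  have hQ0 : 0 ≤ Q := (abs_nonneg _).trans (hQ x hx (by simp; positivity))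
  have e3 : |x - ξ| ≤ ε := by rw [abs_sub_comm]; exact (hlen ξ hξ').trans (by linarith)
  have e4 : Q * |x - ξ| ≤ Q * ε := by gcongr
  have := abs_sub_abs_le_abs_sub (p1 x) (p1 ξ)
  linarith

lemma EE_pos (m ε x : ℝ) : 0 < EE m ε x := by unfold EE; positivity

lemma EE_le_two (m ε x : ℝ) (hm : 0 < m) (hε : 0 < ε) (hx : x ∈ Icc (0:ℝ) 1) : EE m ε x ≤ 2 := by
  unfold EE
  have h1 : Real.exp (-(m*x/ε)) ≤ 1 := by
    rw [Real.exp_le_one_iff]; have := hx.1; have : 0 ≤ m*x/ε := by positivity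
    linarith
  have h2 : Real.exp (-(m*(1-x)/ε)) ≤ 1 := by
    rw [Real.exp_le_one_iff]
    have : 0 ≤ 1 - x := by linarith [hx.2]
    have : 0 ≤ m*(1-x)/ε := by positivity
    linarith
  linarith

lemma EE_zero (m ε : ℝ) : 1 ≤ EE m ε 0 := by
  unfold EE; simp; positivity
lemma EE_one (m ε : ℝ) : 1 ≤ EE m ε 1 := by
  unfold EE; simp; positivity

lemma EE_var (m ε x y : ℝ) (hm : 0 < m) (hε : 0 < ε) (hxy : |y - x| ≤ ε / 2) :
    EE m ε y ≤ Real.exp (m/2) * EE m ε x := by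
  unfold EE
  rw [mul_add, ← Real.exp_add, ← Real.exp_add]
  have h := abs_le.1 hxy
  gcongr
  · rw [← sub_nonneg]
    have : m/2 + -(m*x/ε) - -(m*y/ε) = m * (ε/2 + (y - x))/ε := by field_simp; ring
    rw [this]
    have : 0 ≤ ε/2 + (y-x) := by linarith
    positivity
  · rw [← sub_nonneg]
    have : m/2 + -(m*(1-x)/ε) - -(m*(1-y)/ε) = m * (ε/2 - (y - x))/ε := by field_simp; ring
    rw [this]
    have : 0 ≤ ε/2 - (y-x) := by linarith
    positivity

def EE1 (m ε x : ℝ) : ℝ := (m/ε) * (-Real.exp (-(m*x/ε)) + Real.exp (-(m*(1-x)/ε)))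

lemma EE_d1 (m ε x : ℝ) : HasDerivAt (EE m ε) (EE1 m ε x) x := by
  have h1 : HasDerivAt (fun x : ℝ => -(m*x/ε)) (-(m*1/ε)) x :=
    (((hasDerivAt_id x).const_mul m).div_const ε).neg
  have h2 : HasDerivAt (fun x : ℝ => -(m*(1-x)/ε)) (-(m*(-1)/ε)) x :=
    ((((hasDerivAt_id x).const_sub 1).const_mul m).div_const ε).neg
  have := h1.exp.add h2.exp
  refine this.congr_deriv ?_
  unfold EE1; ring

lemma EE_d2 (m ε x : ℝ) : HasDerivAt (EE1 m ε) (m^2/ε^2 * EE m ε x) x := by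
  have h1 : HasDerivAt (fun x : ℝ => -(m*x/ε)) (-(m*1/ε)) x :=
    (((hasDerivAt_id x).const_mul m).div_const ε).neg
  have h2 : HasDerivAt (fun x : ℝ => -(m*(1-x)/ε)) (-(m*(-1)/ε)) x :=
    ((((hasDerivAt_id x).const_sub 1).const_mul m).div_const ε).neg
  have := (h1.exp.neg.add h2.exp).const_mul (m/ε)
  refine this.congr_deriv ?_
  unfold EE; ring

lemma barrier1 (v v1 v2 r b : ℝ → ℝ) (c m ε R0 R1 D0 D1 : ℝ) (hε : 0 < ε)
    (h1 : ∀ x ∈ Icc (0:ℝ) 1, HasDerivWithinAt v (v1 x) (Icc 0 1) x)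
    (h2 : ∀ x ∈ Icc (0:ℝ) 1, HasDerivWithinAt v1 (v2 x) (Icc 0 1) x)
    (heq : ∀ x ∈ Icc (0:ℝ) 1, ε^2 * v2 x = r x + b x * v x)
    (hb : ∀ x ∈ Icc (0:ℝ) 1, c^2 ≤ b x)
    (hr : ∀ x ∈ Icc (0:ℝ) 1, -(R0 + R1 * EE m ε x) ≤ r x)
    (hD0 : 0 ≤ D0) (hD1 : 0 ≤ D1) (hR0 : R0 < c^2 * D0) (hR1 : R1 ≤ (c^2 - m^2) * D1)
    (hv0 : v 0 ≤ D1) (hv1 : v 1 ≤ D1) :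
    ∀ x ∈ Icc (0:ℝ) 1, v x ≤ D0 + D1 * EE m ε x := by
  have key := maxPr (fun x => v x - (D0 + D1 * EE m ε x)) (fun x => v1 x - D1 * EE1 m ε x)
    (fun x => v2 x - D1 * (m^2/ε^2 * EE m ε x))
    (fun x hx => (h1 x hx).sub
      ((((EE_d1 m ε x).const_mul D1).const_add D0).hasDerivWithinAt))
    (fun x hx => (h2 x hx).sub (((EE_d2 m ε x).const_mul D1).hasDerivWithinAt))
    (by
      have := mul_le_mul_of_nonneg_left (EE_zero m ε) hD1
      linarith)
    (by
      have := mul_le_mul_of_nonneg_left (EE_one m ε) hD1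
      linarith)
    (by
      intro x hx hz
      have hE := EE_pos m ε x
      have hv : 0 ≤ v x := by
        have : 0 ≤ D1 * EE m ε x := by positivity
        linarith
      have a1 : c^2 * v x ≤ b x * v x := mul_le_mul_of_nonneg_right (hb x hx) hv
      have a2 : c^2 * (D0 + D1 * EE m ε x) ≤ c^2 * v x :=
        mul_le_mul_of_nonneg_left (by linarith) (sq_nonneg c)
      have a3 := mul_le_mul_of_nonneg_right hR1 hE.le
      have a4 := hr x hx
      have a5 := heq x hx
      have : 0 < ε^2 * (v2 x - D1 * (m^2/ε^2 * EE m ε x)) := by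
        have : ε^2 * (v2 x - D1 * (m^2/ε^2 * EE m ε x)) = ε^2 * v2 x - D1 * m^2 * EE m ε x := by
          field_simp
        rw [this, a5]
        nlinarith
      exact pos_of_mul_pos_right this (by positivity))
  intro x hx
  have := key x hx
  linarith

lemma barrier (v v1 v2 r b : ℝ → ℝ) (c m ε R0 R1 D0 D1 : ℝ) (hε : 0 < ε)
    (h1 : ∀ x ∈ Icc (0:ℝ) 1, HasDerivWithinAt v (v1 x) (Icc 0 1) x)
    (h2 : ∀ x ∈ Icc (0:ℝ) 1, HasDerivWithinAt v1 (v2 x) (Icc 0 1) x)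
    (heq : ∀ x ∈ Icc (0:ℝ) 1, ε^2 * v2 x = r x + b x * v x)
    (hb : ∀ x ∈ Icc (0:ℝ) 1, c^2 ≤ b x)
    (hr : ∀ x ∈ Icc (0:ℝ) 1, |r x| ≤ R0 + R1 * EE m ε x)
    (hD0 : 0 ≤ D0) (hD1 : 0 ≤ D1) (hR0 : R0 < c^2 * D0) (hR1 : R1 ≤ (c^2 - m^2) * D1)
    (hv0 : |v 0| ≤ D1) (hv1 : |v 1| ≤ D1) :
    ∀ x ∈ Icc (0:ℝ) 1, |v x| ≤ D0 + D1 * EE m ε x := by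
  intro x hx
  rw [abs_le]
  rw [abs_le] at hv0 hv1
  constructor
  · have := barrier1 (fun x => - v x) (fun x => - v1 x) (fun x => - v2 x) (fun x => - r x) b
      c m ε R0 R1 D0 D1 hε (fun x hx => (h1 x hx).neg) (fun x hx => (h2 x hx).neg)
      (fun x hx => by have := heq x hx; linarith) hb
      (fun x hx => by have := (abs_le.1 (hr x hx)).2; linarith)
      hD0 hD1 hR0 hR1 (by linarith) (by linarith) x hx
    linarith
  · exact barrier1 v v1 v2 r b c m ε R0 R1 D0 D1 hε h1 h2 heq hb
      (fun x hx => (abs_le.1 (hr x hx)).1) hD0 hD1 hR0 hR1 hv0.2 hv1.2 x hx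

lemma meanF (f fu : ℝ → ℝ → ℝ) (x : ℝ) (h : ∀ y, HasDerivAt (f x) (fu x y) y) (y z : ℝ) :
    ∃ ξ, |ξ - z| ≤ |y - z| ∧ |ξ| ≤ max |y| |z| ∧ f x y - f x z = fu x ξ * (y - z) := by
  rcases lt_trichotomy y z with hlt | heq | hlt
  · obtain ⟨ξ, hξ, e⟩ := mvt (f x) (fu x) y z hlt (fun t _ => (h t).hasDerivWithinAt)
    refine ⟨ξ, ?_, ?_, by linarith⟩
    · rw [abs_of_neg (by linarith [hξ.2]), abs_of_neg (by linarith)]; linarith [hξ.1]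
    · exact abs_le_max_abs_abs hξ.1.le hξ.2.le
  · subst heq
    exact ⟨y, by simp, by simp, by simp⟩
  · obtain ⟨ξ, hξ, e⟩ := mvt (f x) (fu x) z y hlt (fun t _ => (h t).hasDerivWithinAt)
    refine ⟨ξ, ?_, ?_, by linarith⟩
    · rw [abs_of_pos (by linarith [hξ.1]), abs_of_pos (by linarith)]; linarith [hξ.2]
    · rw [max_comm]; exact abs_le_max_abs_abs hξ.1.le hξ.2.le

lemma solData (f : ℝ → ℝ → ℝ) (hf : ContinuousOn (fun p : ℝ × ℝ => f p.1 p.2) SS)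
    (ε : ℝ) (u : ℝ → ℝ) (hu : IsSolution f ε u) :
    ∃ u1 u2 : ℝ → ℝ, ∀ x ∈ Icc (0:ℝ) 1, HasDerivWithinAt u (u1 x) (Icc 0 1) x ∧
      HasDerivWithinAt u1 (u2 x) (Icc 0 1) x ∧ ε^2 * u2 x = f x (u x) := by
  obtain ⟨hc, he, -, -⟩ := hu
  have hU : UniqueDiffOn ℝ (Icc (0:ℝ) 1) := uniqueDiffOn_Icc (by norm_num)
  have hc1 : ContDiffOn ℝ 3 (derivWithin u (Icc 0 1)) (Icc 0 1) :=
    hc.derivWithin hU (by norm_num)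
  have hc2 : ContDiffOn ℝ 2 (derivWithin (derivWithin u (Icc 0 1)) (Icc 0 1)) (Icc 0 1) :=
    hc1.derivWithin hU (by norm_num)
  have hcf : ContinuousOn (fun x => f x (u x)) (Icc (0:ℝ) 1) := by
    have : ContinuousOn (fun x => (x, u x)) (Icc (0:ℝ) 1) := continuousOn_id.prodMk hc.continuousOn
    exact hf.comp this (fun x hx => ⟨hx, mem_univ _⟩)
  have hEq : EqOn (fun x => ε^2 * derivWithin (derivWithin u (Icc 0 1)) (Icc 0 1) x)
      (fun x => f x (u x)) (Icc 0 1) := by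
    have h0 : EqOn (fun x => ε^2 * derivWithin (derivWithin u (Icc 0 1)) (Icc 0 1) x)
      (fun x => f x (u x)) (Ioo 0 1) := by
      intro x hx
      have := he x hx
      rw [iteratedDerivWithin_succ] at this
      have e2 : derivWithin (iteratedDerivWithin 1 u (Icc (0:ℝ) 1)) (Icc 0 1) x
          = derivWithin (derivWithin u (Icc 0 1)) (Icc 0 1) x := by
        rw [iteratedDerivWithin_one]
      rw [e2] at this
      linarith
    refine h0.of_subset_closure (continuousOn_const.mul hc2.continuousOn) hcf
      Ioo_subset_Icc_self ?_
    rw [closure_Ioo (by norm_num)]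
  refine ⟨derivWithin u (Icc 0 1), derivWithin (derivWithin u (Icc 0 1)) (Icc 0 1), fun x hx => ⟨?_, ?_, hEq hx⟩⟩
  · exact ((hc.differentiableOn (by norm_num)) x hx).hasDerivWithinAt
  · exact ((hc1.differentiableOn (by norm_num)) x hx).hasDerivWithinAt

set_option maxHeartbeats 4000000 in
theorem contA (f : ℝ → ℝ → ℝ) (c₀ : ℝ) (hc₀ : 0 < c₀) (hf : SmoothF f) (hfu : LowerF f c₀) :
    ∃ K : ℝ, 0 < K ∧ ∀ ε : ℝ, 0 < ε → ε ≤ 1 → ∀ u : ℝ → ℝ, IsSolution f ε u →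
    ∃ u1 u2 g1 g2 : ℝ → ℝ, ∀ x ∈ Icc (0:ℝ) 1,
      HasDerivWithinAt u (u1 x) (Icc 0 1) x ∧
      HasDerivWithinAt u1 (u2 x) (Icc 0 1) x ∧
      HasDerivWithinAt (fun x => ε^2 * u2 x) (g1 x) (Icc 0 1) x ∧
      HasDerivWithinAt g1 (g2 x) (Icc 0 1) x ∧
      ε^2 * u2 x = f x (u x) ∧
      |u x| ≤ K ∧ |u2 x| ≤ K * (1 + EE (c₀/2) ε x / ε^2) ∧
      |g1 x| ≤ K * (ε + EE (c₀/2) ε x / ε) ∧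
      |g2 x| ≤ K * (1 + EE (c₀/2) ε x / ε^2) := by
  obtain ⟨fx, fu, cfx, cfu, dxf, duf⟩ := chainF f 3 hf
  obtain ⟨fxx, fxu, cfxx, cfxu, dxfx, dufx⟩ := chainF fx 2 cfx
  obtain ⟨fux, fuu, cfux, cfuu, dxfu, dufu⟩ := chainF fu 2 cfu
  have hfuL : ∀ x ∈ Icc (0:ℝ) 1, ∀ y, c₀^2 ≤ fu x y := by
    intro x hx y
    have := hfu x hx y
    rwa [pderiv1, (duf x hx y).deriv] at this
  have hc2 : 0 < c₀^2 := by positivity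
  obtain ⟨M0, hM0, bM0⟩ := bddF f hf.continuousOn 0
  obtain ⟨L, hL⟩ : ∃ z : ℝ, z = M0 / c₀^2 + 1 := ⟨_, rfl⟩
  have hL0 : 0 < L := by rw [hL]; positivity
  obtain ⟨Ma, hMa, bMa⟩ := bddF f hf.continuousOn L
  obtain ⟨Mb, hMb, bMb⟩ := bddF fx cfx.continuousOn L
  obtain ⟨Mc, hMc, bMc⟩ := bddF fu cfu.continuousOn L
  obtain ⟨Md, hMd, bMd⟩ := bddF fxx cfxx.continuousOn L
  obtain ⟨Me, hMe, bMe⟩ := bddF fxu cfxu.continuousOn L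
  obtain ⟨Mf, hMf, bMf⟩ := bddF fux cfux.continuousOn L
  obtain ⟨Mg, hMg, bMg⟩ := bddF fuu cfuu.continuousOn L
  obtain ⟨M, hM⟩ : ∃ z : ℝ, z = Ma + Mb + Mc + Md + Me + Mf + Mg := ⟨_, rfl⟩
  have hMpos : 0 < M := by rw [hM]; positivity
  set m := c₀/2 with hm
  have hmpos : 0 < m := by positivity
  obtain ⟨C1, hC1⟩ : ∃ z : ℝ, z = M / c₀^2 + 1 := ⟨_, rfl⟩
  have hC1p : 0 < C1 := by rw [hC1]; positivity
  obtain ⟨C2, hC2⟩ : ∃ z : ℝ, z = 4 * L + M := ⟨_, rfl⟩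
  have hC2p : 0 < C2 := by rw [hC2]; positivity
  obtain ⟨R0, hR0⟩ : ∃ z : ℝ, z = 2 * M * (1 + C1)^2 := ⟨_, rfl⟩
  obtain ⟨R1, hR1⟩ : ∃ z : ℝ, z = 4 * M * C2^2 := ⟨_, rfl⟩
  have hR0p : 0 < R0 := by rw [hR0]; positivity
  have hR1p : 0 < R1 := by rw [hR1]; positivity
  obtain ⟨D0, hD0⟩ : ∃ z : ℝ, z = R0 / c₀^2 + 1 := ⟨_, rfl⟩
  have hD0p : 0 < D0 := by rw [hD0]; positivity
  have hcm : 0 < c₀^2 - m^2 := by rw [hm]; nlinarith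
  obtain ⟨D1, hD1⟩ : ∃ z : ℝ, z = R1 / (c₀^2 - m^2) + M := ⟨_, rfl⟩
  have hD1p : 0 < D1 := by rw [hD1]; positivity
  obtain ⟨K2, hK2⟩ : ∃ z : ℝ, z = R0 + R1 + M * (D0 + D1) := ⟨_, rfl⟩
  have hK2p : 0 < K2 := by rw [hK2]; positivity
  obtain ⟨e, he⟩ : ∃ z : ℝ, z = Real.exp (m/2) := ⟨_, rfl⟩
  have he1 : 1 ≤ e := by rw [he]; exact Real.one_le_exp (by positivity)
  refine ⟨L + D0 + D1 + K2 + (4 * (D0 + D1) + K2) * e, by positivity, ?_⟩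
  intro ε hε hε1 u hu
  obtain ⟨u1, u2, hud⟩ := solData f hf.continuousOn ε u hu
  obtain ⟨-, -, hu0, hu1⟩ := hu
  have du : ∀ x ∈ Icc (0:ℝ) 1, HasDerivWithinAt u (u1 x) (Icc 0 1) x := fun x hx => (hud x hx).1
  have du1 : ∀ x ∈ Icc (0:ℝ) 1, HasDerivWithinAt u1 (u2 x) (Icc 0 1) x := fun x hx => (hud x hx).2.1
  have hg : ∀ x ∈ Icc (0:ℝ) 1, ε^2 * u2 x = f x (u x) := fun x hx => (hud x hx).2.2
  -- bound on u
  have hmean : ∀ x, ∃ b : ℝ, x ∈ Icc (0:ℝ) 1 → c₀^2 ≤ b ∧ f x (u x) - f x 0 = b * (u x - 0) := by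
    intro x
    by_cases hx : x ∈ Icc (0:ℝ) 1
    · obtain ⟨ξ, -, -, h⟩ := meanF f fu x (duf x hx) (u x) 0
      exact ⟨fu x ξ, fun _ => ⟨hfuL x hx ξ, h⟩⟩
    · exact ⟨0, fun h => absurd h hx⟩
  choose b hb using hmean
  have hub : ∀ x ∈ Icc (0:ℝ) 1, |u x| ≤ L := by
    intro x hx
    have := barrier u u1 u2 (fun x => f x 0) b c₀ m ε M0 0 L 0 hε du du1
      (fun x hx => by have := (hb x hx).2; have := hg x hx; linarith)
      (fun x hx => (hb x hx).1)
      (fun x hx => by have := bM0 x hx 0 (by simp); linarith)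
      hL0.le le_rfl (by rw [hL]; field_simp; nlinarith) (by simp) (by simp [hu0]) (by simp [hu1]) x hx
    linarith
  have Bf : ∀ x ∈ Icc (0:ℝ) 1, |f x (u x)| ≤ M := fun x hx => (bMa x hx _ (hub x hx)).trans (by linarith)
  have Bfx : ∀ x ∈ Icc (0:ℝ) 1, |fx x (u x)| ≤ M := fun x hx => (bMb x hx _ (hub x hx)).trans (by linarith)
  have Bfu : ∀ x ∈ Icc (0:ℝ) 1, |fu x (u x)| ≤ M := fun x hx => (bMc x hx _ (hub x hx)).trans (by linarith)
  have Bfxx : ∀ x ∈ Icc (0:ℝ) 1, |fxx x (u x)| ≤ M := fun x hx => (bMd x hx _ (hub x hx)).trans (by linarith)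
  have Bfxu : ∀ x ∈ Icc (0:ℝ) 1, |fxu x (u x)| ≤ M := fun x hx => (bMe x hx _ (hub x hx)).trans (by linarith)
  have Bfux : ∀ x ∈ Icc (0:ℝ) 1, |fux x (u x)| ≤ M := fun x hx => (bMf x hx _ (hub x hx)).trans (by linarith)
  have Bfuu : ∀ x ∈ Icc (0:ℝ) 1, |fuu x (u x)| ≤ M := fun x hx => (bMg x hx _ (hub x hx)).trans (by linarith)
  have hε2 : 0 < ε^2 := by positivity
  have Bu2 : ∀ x ∈ Icc (0:ℝ) 1, |u2 x| ≤ M / ε^2 := by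
    intro x hx
    rw [le_div_iff₀ hε2]
    have := Bf x hx
    rw [← hg x hx, abs_mul, abs_of_pos hε2] at this
    linarith
  have Bu1 : ∀ x ∈ Icc (0:ℝ) 1, |u1 x| ≤ C2 / ε := by
    intro x hx
    have := interp1 u u1 u2 du du1 ε hε hε1 x hx L (M/ε^2) (fun y hy _ => hub y hy)
      (fun y hy _ => Bu2 y hy)
    have e : 4 * L / ε + M / ε^2 * ε = C2 / ε := by rw [hC2]; field_simp
    rwa [e] at this
  set g1 : ℝ → ℝ := fun x => fx x (u x) + fu x (u x) * u1 x with hg1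
  set Q : ℝ → ℝ := fun x => fxx x (u x) + fxu x (u x) * u1 x
    + (fux x (u x) + fuu x (u x) * u1 x) * u1 x with hQ
  set g2 : ℝ → ℝ := fun x => Q x + fu x (u x) * u2 x with hg2
  have dg : ∀ x ∈ Icc (0:ℝ) 1, HasDerivWithinAt (fun x => ε^2 * u2 x) (g1 x) (Icc 0 1) x := by
    intro x hx
    exact (dxf x hx u (u1 x) (du x hx)).congr (fun y hy => hg y hy) (hg x hx)
  have dg1 : ∀ x ∈ Icc (0:ℝ) 1, HasDerivWithinAt g1 (g2 x) (Icc 0 1) x := by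
    intro x hx
    have := (dxfx x hx u (u1 x) (du x hx)).add ((dxfu x hx u (u1 x) (du x hx)).mul (du1 x hx))
    refine this.congr_deriv ?_
    simp only [hg2, hQ]; ring
  have du2 : ∀ x ∈ Icc (0:ℝ) 1, HasDerivWithinAt u2 (g1 x / ε^2) (Icc 0 1) x := by
    intro x hx
    refine ((dg x hx).div_const (ε^2)).congr (fun y _ => ?_) ?_ <;> field_simp
  have du3 : ∀ x ∈ Icc (0:ℝ) 1, HasDerivWithinAt (fun x => g1 x / ε^2) (g2 x / ε^2) (Icc 0 1) x :=
    fun x hx => (dg1 x hx).div_const _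
  have h0m : (0:ℝ) ∈ Icc (0:ℝ) 1 := by simp
  have h1m : (1:ℝ) ∈ Icc (0:ℝ) 1 := by simp
  have Bu1' : ∀ x ∈ Icc (0:ℝ) 1, |u1 x| ≤ C1 + C2 / ε * EE m ε x := by
    refine barrier u1 u2 (fun x => g1 x / ε^2) (fun x => fx x (u x)) (fun x => fu x (u x))
      c₀ m ε M 0 C1 (C2/ε) hε du1 du2 ?_ ?_ ?_ hC1p.le (by positivity) ?_ (by positivity)
      (Bu1 0 h0m) (Bu1 1 h1m)
    · intro x hx; simp only [hg1]; field_simp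
    · intro x hx; exact hfuL x hx _
    · intro x hx; have := Bfx x hx; linarith
    · rw [hC1]; field_simp; linarith
  have BQ : ∀ x ∈ Icc (0:ℝ) 1, |Q x| ≤ R0 + R1 / ε^2 * EE m ε x := by
    intro x hx
    have hE := EE_pos m ε x
    have hE2 := EE_le_two m ε x hmpos hε hx
    set w := |u1 x| with hw
    have hw0 : 0 ≤ w := abs_nonneg _
    have t1 : |Q x| ≤ M * (1 + w)^2 := by
      simp only [hQ]
      have b1 := Bfxx x hx
      have b2 : |fxu x (u x) * u1 x| ≤ M * w := by
        rw [abs_mul]; exact mul_le_mul_of_nonneg_right (Bfxu x hx) hw0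
      have b3 : |fuu x (u x) * u1 x| ≤ M * w := by
        rw [abs_mul]; exact mul_le_mul_of_nonneg_right (Bfuu x hx) hw0
      have b4 : |(fux x (u x) + fuu x (u x) * u1 x) * u1 x| ≤ (M + M * w) * w := by
        rw [abs_mul]
        exact mul_le_mul_of_nonneg_right
          ((abs_add_le _ _).trans (add_le_add (Bfux x hx) b3)) hw0
      calc _ ≤ M + M * w + (M + M * w) * w :=
            (abs_add_le _ _).trans (add_le_add ((abs_add_le _ _).trans (add_le_add b1 b2)) b4)
        _ = _ := by ring
    have t2 : (1 + w)^2 ≤ 2 * (1 + C1)^2 + 2 * (C2/ε * EE m ε x)^2 := by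
      have : (1 + w) ≤ (1 + C1) + C2/ε * EE m ε x := by have := Bu1' x hx; linarith
      calc (1 + w)^2 ≤ ((1 + C1) + C2/ε * EE m ε x)^2 := by gcongr
        _ ≤ _ := by nlinarith [sq_nonneg ((1 + C1) - C2/ε * EE m ε x)]
    have t3 : (C2/ε * EE m ε x)^2 ≤ C2^2/ε^2 * (2 * EE m ε x) := by
      rw [mul_pow, div_pow]
      gcongr
      nlinarith
    calc |Q x| ≤ M * (1 + w)^2 := t1
      _ ≤ M * (2 * (1 + C1)^2 + 2 * (C2^2/ε^2 * (2 * EE m ε x))) := by gcongr; linarith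
      _ = _ := by rw [hR0, hR1]; ring
  have Bu2' : ∀ x ∈ Icc (0:ℝ) 1, |u2 x| ≤ D0 + D1 / ε^2 * EE m ε x := by
    have hMD : M / ε^2 ≤ D1 / ε^2 := by
      gcongr; rw [hD1]; have : 0 < R1 / (c₀^2 - m^2) := by positivity
      linarith
    refine barrier u2 (fun x => g1 x / ε^2) (fun x => g2 x / ε^2) Q (fun x => fu x (u x))
      c₀ m ε R0 (R1/ε^2) D0 (D1/ε^2) hε du2 du3 ?_ ?_ BQ hD0p.le (by positivity) ?_ ?_
      ((Bu2 0 h0m).trans hMD) ((Bu2 1 h1m).trans hMD)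
    · intro x hx; simp only [hg2]; field_simp
    · intro x hx; exact hfuL x hx _
    · rw [hD0]; field_simp; linarith
    · rw [← mul_div_assoc]; gcongr; rw [hD1, mul_add, mul_div_cancel₀ _ hcm.ne']
      have : 0 < (c₀^2 - m^2) * M := by positivity
      linarith
  have Bg2 : ∀ x ∈ Icc (0:ℝ) 1, |g2 x| ≤ K2 * (1 + EE m ε x / ε^2) := by
    intro x hx
    have hE := EE_pos m ε x
    have b1 : |fu x (u x) * u2 x| ≤ M * (D0 + D1 / ε^2 * EE m ε x) := by
      rw [abs_mul]; exact mul_le_mul (Bfu x hx) (Bu2' x hx) (abs_nonneg _) hMpos.le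
    have b2 : |g2 x| ≤ R0 + R1 / ε^2 * EE m ε x + M * (D0 + D1 / ε^2 * EE m ε x) :=
      (abs_add_le _ _).trans (add_le_add (BQ x hx) b1)
    set t := EE m ε x / ε^2 with ht
    have ht0 : 0 < t := by positivity
    have e1 : R1 / ε^2 * EE m ε x = R1 * t := by rw [ht]; ring
    have e2 : D1 / ε^2 * EE m ε x = D1 * t := by rw [ht]; ring
    rw [e1, e2] at b2
    have : K2 * (1 + t) - (R0 + R1 * t + M * (D0 + D1 * t)) = R0 * t + R1 + M * (D0 * t + D1) := by
      rw [hK2]; ring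
    have : 0 < R0 * t + R1 + M * (D0 * t + D1) := by positivity
    linarith
  have Bg1 : ∀ x ∈ Icc (0:ℝ) 1, |g1 x| ≤ ((4 * (D0 + D1) + K2) * e) * (ε + EE m ε x / ε) := by
    intro x hx
    have hE := EE_pos m ε x
    have := interp1 (fun x => ε^2 * u2 x) g1 g2 dg dg1 ε hε hε1 x hx
      (ε^2 * (D0 + D1 / ε^2 * (e * EE m ε x))) (K2 * (1 + e * EE m ε x / ε^2))
      (fun y hy hxy => by
        rw [abs_mul, abs_of_pos hε2]
        gcongr
        refine (Bu2' y hy).trans ?_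
        gcongr
        rw [he]
        exact EE_var m ε x y hmpos hε hxy)
      (fun y hy hxy => by
        refine (Bg2 y hy).trans ?_
        gcongr
        rw [he]
        exact EE_var m ε x y hmpos hε hxy)
    refine this.trans ?_
    set t := EE m ε x / ε with ht
    have ht0 : 0 < t := by positivity
    have e1 : 4 * (ε^2 * (D0 + D1 / ε^2 * (e * EE m ε x))) / ε + K2 * (1 + e * EE m ε x / ε^2) * ε
        = 4 * (D0 * ε + D1 * e * t) + K2 * (ε + e * t) := by
      rw [ht]; field_simp
    rw [e1]
    have : ((4 * (D0 + D1) + K2) * e) * (ε + t) - (4 * (D0 * ε + D1 * e * t) + K2 * (ε + e * t))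
      = 4 * D0 * e * t + 4 * D1 * e * ε + (4 * D0 + K2) * ε * (e - 1) := by ring
    have h3 : 0 ≤ 4 * D0 * e * t + 4 * D1 * e * ε + (4 * D0 + K2) * ε * (e - 1) := by
      have : 0 ≤ e - 1 := by linarith
      positivity
    linarith
  refine ⟨u1, u2, g1, g2, fun x hx => ⟨du x hx, du1 x hx, dg x hx, dg1 x hx, hg x hx, ?_, ?_, ?_, ?_⟩⟩
  · refine (hub x hx).trans ?_
    have : 0 < (4 * (D0 + D1) + K2) * e := by positivity
    linarith
  · refine (Bu2' x hx).trans ?_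
    have hE := EE_pos m ε x
    have e2 : D0 + D1 / ε^2 * EE m ε x ≤ (D0 + D1) * (1 + EE m ε x / ε^2) := by
      have : (D0 + D1) * (1 + EE m ε x / ε^2) - (D0 + D1 / ε^2 * EE m ε x) = D0 * (EE m ε x / ε^2) + D1 := by
        ring
      have : 0 < D0 * (EE m ε x / ε^2) + D1 := by positivity
      linarith
    refine e2.trans ?_
    have : 0 < (4 * (D0 + D1) + K2) * e := by positivity
    refine mul_le_mul_of_nonneg_right ?_ (by positivity)
    linarith
  · refine (Bg1 x hx).trans ?_
    have hE := EE_pos m ε x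
    refine mul_le_mul_of_nonneg_right ?_ (by positivity)
    linarith
  · refine (Bg2 x hx).trans ?_
    have hE := EE_pos m ε x
    have : 0 < (4 * (D0 + D1) + K2) * e := by positivity
    refine mul_le_mul_of_nonneg_right ?_ (by positivity)
    linarith

/-- abstract properties of the mesh generating function -/
structure MeshP (a q κ ε : ℝ) (lam sf : ℝ → ℝ) : Prop where
  d : ∀ t, HasDerivAt lam (a*ε*q/(sf t)^2) t
  l0 : lam 0 = 0
  l1 : lam 1 = 1
  lip : ∀ t r, |sf t - sf r| ≤ |t - r|
  pos : ∀ t, 0 < sf t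
  le : ∀ t ∈ Icc (0:ℝ) 1, sf t ≤ 1
  low : ∀ t, κ * ε ≤ (sf t)^2
  exp : ∀ m : ℝ, 0 < m → ∀ t ∈ Icc (0:ℝ) 1,
    EE m ε (lam t) ≤ 2 * Real.exp (m*a) * Real.exp (-(m*a*q/sf t))

lemma alpha_facts (a q ε : ℝ) (hq0 : 0 < q) (hq1 : q < 1/2) (ha : 0 < a) (hε : 0 < ε)
    (haq : a*ε < q) :
    0 < vulAlpha a ε q ∧ vulAlpha a ε q < q ∧
    vulMu a ε q (vulAlpha a ε q) + vulMu' a ε q (vulAlpha a ε q) * (1/2 - vulAlpha a ε q) = 1/2 ∧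
    (a*q*(1-2*q)/(1+2*q)^2) * ε ≤ (q - vulAlpha a ε q)^2 := by
  obtain ⟨A, hA⟩ : ∃ A, A = a * ε := ⟨_, rfl⟩
  have hA0 : 0 < A := by rw [hA]; positivity
  have hAq : A < q := by rw [hA]; exact haq
  obtain ⟨S, hS⟩ : ∃ S, S = Real.sqrt (ε*a*q*(1-2*q+2*ε*a)) := ⟨_, rfl⟩
  have harg : ε*a*q*(1-2*q+2*ε*a) = A*q*(1-2*q+2*A) := by rw [hA]; ring
  have h12 : 0 < 1 - 2*q := by linarith
  have hargp : 0 < A*q*(1-2*q+2*A) := by positivity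
  have hS0 : 0 < S := by rw [hS, harg]; exact Real.sqrt_pos.2 hargp
  have hS2 : S^2 = A*q*(1-2*q+2*A) := by rw [hS, harg]; exact Real.sq_sqrt hargp.le
  have hα : vulAlpha a ε q = (q - S)/(1+2*A) := by
    unfold vulAlpha; rw [hS, hA]; ring_nf
  obtain ⟨α, hαd⟩ : ∃ α, α = vulAlpha a ε q := ⟨_, rfl⟩
  rw [← hαd] at hα ⊢
  have hA1 : 0 < 1 + 2*A := by positivity
  have hαe : α * (1+2*A) = q - S := by rw [hα]; field_simp
  have hSq : S < q := by
    by_contra h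
    push Not at h
    have : q^2 ≤ S^2 := by gcongr
    rw [hS2] at this
    nlinarith [mul_pos hq0 hA1, mul_pos hA0 hq0]
  have h1 : 0 < α := by rw [hα]; apply div_pos <;> linarith
  have h2 : α < q := by
    rw [hα, div_lt_iff₀ hA1]; nlinarith
  have hqa : (q - α) * (1+2*A) = 2*A*q + S := by linarith
  refine ⟨h1, h2, ?_, ?_⟩
  · unfold vulMu vulMu'
    rw [← hA]
    have : q - α ≠ 0 := by linarith
    field_simp
    have : (S - q + α*(1+2*A)) = 0 := by linarith
    have hSe : S = q - α*(1+2*A) := by linarith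
    have hS2' : (q - α*(1+2*A))^2 = A*q*(1-2*q+2*A) := by rw [← hSe]; exact hS2
    have hfac : (1+2*A) * ((1+2*A)*α^2 - 2*q*α + q^2 - A*q) = 0 := by nlinarith
    have := (mul_eq_zero.1 hfac).resolve_left hA1.ne'
    nlinarith
  · have h3 : (a*q*(1-2*q)/(1+2*q)^2) * ε = A*q*(1-2*q)/(1+2*q)^2 := by rw [hA]; ring
    rw [h3, div_le_iff₀ (by positivity)]
    have h4 : S ≤ (q-α)*(1+2*q) := by
      have : 0 < q - α := by linarith
      nlinarith [mul_pos hA0 hq0]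
    calc A*q*(1-2*q) ≤ S^2 := by rw [hS2]; nlinarith [mul_pos (mul_pos hA0 hq0) hA0]
      _ ≤ ((q-α)*(1+2*q))^2 := by gcongr
      _ = _ := by ring

lemma lam_left (a q ε : ℝ) (_hα : vulAlpha a ε q < 1/2)
    (ht : vulMu a ε q (vulAlpha a ε q) + vulMu' a ε q (vulAlpha a ε q) * (1/2 - vulAlpha a ε q) = 1/2)
    (t : ℝ) (h : t ≤ 1 - vulAlpha a ε q) :
    vulLam a ε q t = if t ≤ vulAlpha a ε q then vulMu a ε q t
      else vulMu a ε q (vulAlpha a ε q) + vulMu' a ε q (vulAlpha a ε q) * (t - vulAlpha a ε q) := by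
  unfold vulLam
  simp only
  generalize vulAlpha a ε q = α at *
  by_cases h1 : t ≤ α
  · simp [h1]
  · rw [if_neg h1, if_neg h1]
    by_cases h2 : t ≤ 1/2
    · rw [if_pos h2]
    · rw [if_neg h2]
      by_cases h3 : 1 - t ≤ α
      · have : t = 1 - α := by linarith
        subst this
        rw [if_pos h3]
        have : 1 - (1 - α) = α := by ring
        rw [this]
        nlinarith
      · rw [if_neg h3]; nlinarith

lemma lam_symm (a q ε : ℝ) (hα : vulAlpha a ε q < 1/2)
    (ht : vulMu a ε q (vulAlpha a ε q) + vulMu' a ε q (vulAlpha a ε q) * (1/2 - vulAlpha a ε q) = 1/2)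
    (t : ℝ) : vulLam a ε q (1 - t) = 1 - vulLam a ε q t := by
  unfold vulLam
  simp only
  generalize vulAlpha a ε q = α at *
  have e : 1 - (1 - t) = t := by ring
  rw [e]
  rcases lt_trichotomy t (1/2) with h | h | h
  · rw [if_neg (by linarith : ¬ (1 - t ≤ α)), if_neg (by linarith : ¬ (1 - t ≤ 1/2))]
    by_cases h1 : t ≤ α
    · simp [h1]
    · rw [if_neg h1, if_neg h1, if_pos h.le]
  · subst h
    have e2 : (1:ℝ) - 1/2 = 1/2 := by norm_num
    rw [e2, if_neg (by linarith), if_pos le_rfl]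
    linarith
  · have h3 : ¬ (t ≤ α) := by linarith
    have h4 : ¬ (t ≤ 1/2) := by linarith
    have h5 : 1 - t ≤ 1/2 := by linarith
    by_cases h1 : 1 - t ≤ α
    · rw [if_pos h1, if_neg h3, if_neg h4, if_pos h1]; ring
    · rw [if_neg h1, if_pos h5, if_neg h3, if_neg h4, if_neg h1]; ring

def sfun (q α t : ℝ) : ℝ := q - min (min t (1-t)) α

lemma lam_deriv_left (a q ε : ℝ) (hαq : vulAlpha a ε q < q) (hα : vulAlpha a ε q < 1/2)
    (ht : vulMu a ε q (vulAlpha a ε q) + vulMu' a ε q (vulAlpha a ε q) * (1/2 - vulAlpha a ε q) = 1/2)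
    (t : ℝ) (h : t < 1 - vulAlpha a ε q) :
    HasDerivAt (vulLam a ε q) (a*ε*q/(sfun q (vulAlpha a ε q) t)^2) t := by
  have hl := lam_left a q ε hα ht
  generalize vulAlpha a ε q = α at *
  have dmu : ∀ t < q, HasDerivAt (vulMu a ε q) (a*ε*q/(q-t)^2) t := by
    intro t h
    have h1 : HasDerivAt (fun t : ℝ => a*ε*t) (a*ε*1) t := (hasDerivAt_id t).const_mul (a*ε)
    have h2 : HasDerivAt (fun t : ℝ => q - t) (-1) t := (hasDerivAt_id t).const_sub q
    have := h1.div h2 (by linarith)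
    refine this.congr_deriv ?_
    congr 1
    ring
  have dl : ∀ t, HasDerivAt (fun t => vulMu a ε q α + vulMu' a ε q α * (t - α)) (a*ε*q/(q-α)^2) t := by
    intro t
    have := (((hasDerivAt_id t).sub_const α).const_mul (vulMu' a ε q α)).const_add (vulMu a ε q α)
    refine this.congr_deriv ?_
    unfold vulMu'; ring
  rcases lt_trichotomy t α with h1 | h1 | h1
  · have hs : sfun q α t = q - t := by
      have h5 : t ≤ 1 - t := by linarith
      unfold sfun; rw [min_eq_left h5, min_eq_left h1.le]
    rw [hs]
    refine (dmu t (by linarith)).congr_of_eventuallyEq ?_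
    filter_upwards [Iio_mem_nhds h1] with x hx
    have hx : x < α := hx
    rw [hl x (by linarith), if_pos hx.le]
  · subst h1
    have hs : sfun q t t = q - t := by
      unfold sfun; rw [min_eq_left h.le, min_self]
    rw [hs]
    have d1 : HasDerivWithinAt (vulLam a ε q) (a*ε*q/(q-t)^2) (Iic t) t := by
      refine (dmu t hαq).hasDerivWithinAt.congr ?_ ?_
      · intro x hx
        have hx : x ≤ t := hx
        rw [hl x (by linarith), if_pos hx]
      · rw [hl t (by linarith), if_pos le_rfl]
    have d2 : HasDerivWithinAt (vulLam a ε q) (a*ε*q/(q-t)^2) (Ici t) t := by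
      have hev : ∀ x, t ≤ x → x < 1 - t → vulLam a ε q x
          = vulMu a ε q t + vulMu' a ε q t * (x - t) := by
        intro x hx hx2
        rw [hl x hx2.le]
        by_cases h5 : x ≤ t
        · have : x = t := le_antisymm h5 hx
          subst this; simp
        · rw [if_neg h5]
      refine (dl t).hasDerivWithinAt.congr_of_eventuallyEq ?_ (hev t le_rfl h)
      filter_upwards [self_mem_nhdsWithin, nhdsWithin_le_nhds (Iio_mem_nhds h)] with x hx hx2
      exact hev x hx hx2
    have := d1.union d2
    rwa [Iic_union_Ici, hasDerivWithinAt_univ] at this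
  · have hs : sfun q α t = q - α := by
      unfold sfun; rw [min_eq_right]
      exact le_min h1.le (by linarith)
    rw [hs]
    refine (dl t).congr_of_eventuallyEq ?_
    filter_upwards [Ioo_mem_nhds h1 h] with x hx
    rw [hl x hx.2.le, if_neg (by linarith [hx.1])]

theorem vulMeshP (a q ε : ℝ) (hq0 : 0 < q) (hq1 : q < 1/2) (ha : 0 < a) (hε : 0 < ε)
    (haq : a*ε < q) :
    MeshP a q (a*q*(1-2*q)/(1+2*q)^2) ε (vulLam a ε q) (sfun q (vulAlpha a ε q)) := by
  obtain ⟨h1, h2, h3, h4⟩ := alpha_facts a q ε hq0 hq1 ha hε haq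
  have hα : vulAlpha a ε q < 1/2 := by linarith
  have hsym := lam_symm a q ε hα h3
  have hdl := lam_deriv_left a q ε h2 hα h3
  have hl := lam_left a q ε hα h3
  generalize vulAlpha a ε q = α at *
  have hl0 : vulLam a ε q 0 = 0 := by
    rw [hl 0 (by linarith), if_pos h1.le]; unfold vulMu; simp
  have hss : ∀ t, sfun q α (1 - t) = sfun q α t := by
    intro t; unfold sfun
    have : 1 - (1 - t) = t := by ring
    rw [this, min_comm t]
  have hpos : ∀ t, q - α ≤ sfun q α t := by
    intro t; unfold sfun; linarith [min_le_right (min t (1-t)) α]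
  have hd : ∀ t, HasDerivAt (vulLam a ε q) (a*ε*q/(sfun q α t)^2) t := by
    intro t
    rcases lt_or_ge t (1 - α) with h | h
    · exact hdl t h
    · have := hdl (1 - t) (by linarith)
      rw [hss] at this
      have h5 : HasDerivAt (fun t : ℝ => 1 - t) (-1) t := (hasDerivAt_id t).const_sub 1
      have h6 := (this.comp t h5).const_sub 1
      have h7 : (fun x => 1 - (vulLam a ε q ∘ fun t => 1 - t) x) = vulLam a ε q := by
        funext x; simp only [Function.comp]; rw [hsym]; ring
      rw [h7] at h6
      exact h6.congr_deriv (by ring)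
  have hmono : Monotone (vulLam a ε q) := by
    refine monotone_of_deriv_nonneg (fun t => (hd t).differentiableAt) (fun t => ?_)
    rw [(hd t).deriv]; positivity
  refine ⟨hd, hl0, ?_, ?_, ?_, ?_, ?_, ?_⟩
  · have := hsym 0; rw [hl0] at this; simpa using this
  · intro t r
    unfold sfun
    have e : q - min (min t (1-t)) α - (q - min (min r (1-r)) α)
      = min (min r (1-r)) α - min (min t (1-t)) α := by ring
    rw [e]
    have a1 := abs_min_sub_min_le_max (min r (1-r)) α (min t (1-t)) α
    have a2 := abs_min_sub_min_le_max r (1-r) t (1-t)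
    have e2 : 1 - r - (1 - t) = -(r - t) := by ring
    rw [e2, abs_neg, max_self] at a2
    rw [sub_self, abs_zero, max_eq_left (abs_nonneg _)] at a1
    rw [abs_sub_comm t r]
    exact a1.trans a2
  · intro t; linarith [hpos t]
  · intro t ht
    have : 0 ≤ min (min t (1-t)) α := le_min (le_min ht.1 (by linarith [ht.2])) h1.le
    unfold sfun; linarith
  · intro t
    refine h4.trans ?_
    have := hpos t
    have : 0 < q - α := by linarith
    gcongr
  · intro m hm t ht
    set dd := min (min t (1-t)) α with hdd
    have hs : sfun q α t = q - dd := rfl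
    have hsp : 0 < q - dd := by have := hpos t; rw [hs] at this; linarith
    have hda : dd ≤ α := min_le_right _ _
    have hlam : vulLam a ε q dd = a*ε*q/(q-dd) - a*ε := by
      rw [hl dd (by linarith), if_pos hda]
      unfold vulMu; field_simp; ring
    have hx1 : a*ε*q/(q-dd) - a*ε ≤ vulLam a ε q t := by
      rw [← hlam]; exact hmono ((min_le_left _ _).trans (min_le_left _ _))
    have hx2 : a*ε*q/(q-dd) - a*ε ≤ 1 - vulLam a ε q t := by
      rw [← hlam, ← hsym]; exact hmono ((min_le_left _ _).trans (min_le_right _ _))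
    have key : ∀ x, a*ε*q/(q-dd) - a*ε ≤ x →
        Real.exp (-(m*x/ε)) ≤ Real.exp (m*a) * Real.exp (-(m*a*q/(q-dd))) := by
      intro x hx
      rw [← Real.exp_add]
      apply Real.exp_le_exp.2
      have : m * (a*ε*q/(q-dd) - a*ε) / ε ≤ m * x / ε := by gcongr
      have e : m * (a*ε*q/(q-dd) - a*ε) / ε = m*a*q/(q-dd) - m*a := by field_simp
      linarith
    unfold EE
    rw [hs]
    have := key _ hx1
    have := key _ hx2
    linarith

lemma stepT (φ φ1 : ℝ → ℝ) (s t B : ℝ) (k : ℕ) (x : ℝ) (hx : x ∈ Icc s t) (hB : 0 ≤ B)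
    (hd : ∀ y ∈ Icc s t, HasDerivWithinAt φ (φ1 y) (Icc s t) y)
    (hb : ∀ y ∈ Icc s t, |φ1 y| ≤ B * |y - x|^k) (h0 : φ x = 0) :
    ∀ y ∈ Icc s t, |φ y| ≤ B * |y - x|^(k+1) := by
  intro y hy
  have hsub : Icc (min x y) (max x y) ⊆ Icc s t :=
    Icc_subset_Icc (le_min hx.1 hy.1) (max_le hx.2 hy.2)
  have := mvi φ φ1 (min x y) (max x y) (B * |y - x|^k) (min_le_max)
    (fun z hz => (hd z (hsub hz)).mono hsub)
    (fun z hz => by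
      refine (hb z (hsub hz)).trans ?_
      have hzx : |z - x| ≤ |y - x| := by
        rcases le_total x y with h | h
        · rw [min_eq_left h, max_eq_right h] at hz
          rw [abs_of_nonneg (by linarith [hz.1]), abs_of_nonneg (by linarith)]; linarith [hz.2]
        · rw [min_eq_right h, max_eq_left h] at hz
          rw [abs_of_nonpos (by linarith [hz.2]), abs_of_nonpos (by linarith)]; linarith [hz.1]
      gcongr) (x := x) (y := y) ⟨min_le_left _ _, le_max_left _ _⟩ ⟨min_le_right _ _, le_max_right _ _⟩
  rw [h0, sub_zero] at this
  rw [pow_succ]; linarith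

lemma taylor4 (U U1 G g1 g2 : ℝ → ℝ) (s t B x : ℝ) (hx : x ∈ Icc s t) (hB : 0 ≤ B)
    (d0 : ∀ y ∈ Icc s t, HasDerivWithinAt U (U1 y) (Icc s t) y)
    (d1 : ∀ y ∈ Icc s t, HasDerivWithinAt U1 (G y) (Icc s t) y)
    (d2 : ∀ y ∈ Icc s t, HasDerivWithinAt G (g1 y) (Icc s t) y)
    (d3 : ∀ y ∈ Icc s t, HasDerivWithinAt g1 (g2 y) (Icc s t) y)
    (hb : ∀ y ∈ Icc s t, |g2 y| ≤ B) :
    ∀ y ∈ Icc s t, |U y - U x - U1 x * (y - x) - G x * ((y - x)^2/2) - g1 x * ((y - x)^3/6)|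
      ≤ B * |y - x|^4 := by
  have e (y : ℝ) : HasDerivWithinAt (fun y : ℝ => y - x) 1 (Icc s t) y :=
    (hasDerivWithinAt_id y _).sub_const x
  have e2 (y : ℝ) : HasDerivWithinAt (fun y : ℝ => (y - x)^2/2) (y - x) (Icc s t) y := by
    refine (((e y).pow 2).div_const 2).congr_deriv ?_
    simp
  have e3 (y : ℝ) : HasDerivWithinAt (fun y : ℝ => (y - x)^3/6) ((y - x)^2/2) (Icc s t) y := by
    refine (((e y).pow 3).div_const 6).congr_deriv ?_
    simp; ring
  have s1 := stepT (fun y => g1 y - g1 x) g2 s t B 0 x hx hB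
    (fun y hy => (d3 y hy).sub_const _) (fun y hy => by simpa using hb y hy) (by simp)
  have s2 := stepT (fun y => G y - G x - g1 x * (y - x)) (fun y => g1 y - g1 x) s t B 1 x hx hB
    (fun y hy => (((d2 y hy).sub_const _).sub ((e y).const_mul (g1 x))).congr_deriv (by ring))
    s1 (by simp)
  have s3 := stepT (fun y => U1 y - U1 x - G x * (y - x) - g1 x * ((y-x)^2/2))
    (fun y => G y - G x - g1 x * (y - x)) s t B 2 x hx hB
    (fun y hy => ((((d1 y hy).sub_const _).sub ((e y).const_mul (G x))).sub
      ((e2 y).const_mul (g1 x))).congr_deriv (by ring))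
    s2 (by simp)
  exact stepT (fun y => U y - U x - U1 x * (y - x) - G x * ((y - x)^2/2) - g1 x * ((y - x)^3/6))
    (fun y => U1 y - U1 x - G x * (y - x) - g1 x * ((y-x)^2/2)) s t B 3 x hx hB
    (fun y hy => (((((d0 y hy).sub_const _).sub ((e y).const_mul (U1 x))).sub
      ((e2 y).const_mul (G x))).sub ((e3 y).const_mul (g1 x))).congr_deriv (by ring))
    s3 (by simp)

lemma trunc1 (U U1 G g1 g2 : ℝ → ℝ) (l c r B H : ℝ) (hlc : l < c) (hcr : c < r) (hB : 0 ≤ B)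
    (d0 : ∀ y ∈ Icc l r, HasDerivWithinAt U (U1 y) (Icc l r) y)
    (d1 : ∀ y ∈ Icc l r, HasDerivWithinAt U1 (G y) (Icc l r) y)
    (d2 : ∀ y ∈ Icc l r, HasDerivWithinAt G (g1 y) (Icc l r) y)
    (d3 : ∀ y ∈ Icc l r, HasDerivWithinAt g1 (g2 y) (Icc l r) y)
    (hb : ∀ y ∈ Icc l r, |g2 y| ≤ B) (hH1 : c - l ≤ H) (hH2 : r - c ≤ H) :
    |2 / (r - l) * ((U r - U c) / (r - c) - (U c - U l) / (c - l)) - G c|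
      ≤ |g1 c| * |(r - c) - (c - l)| + 2 * B * H^2 := by
  have hT := taylor4 U U1 G g1 g2 l r B c ⟨hlc.le, hcr.le⟩ hB d0 d1 d2 d3 hb
  have t1 := hT r ⟨by linarith, le_rfl⟩
  have t2 := hT l ⟨le_rfl, by linarith⟩
  obtain ⟨k, hk⟩ : ∃ k, k = r - c := ⟨_, rfl⟩
  obtain ⟨h, hh⟩ : ∃ h, h = c - l := ⟨_, rfl⟩
  have hk0 : 0 < k := by linarith
  have hh0 : 0 < h := by linarith
  have e1 : r - l = h + k := by linarith
  have e2 : l - c = -h := by linarith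
  rw [e2, abs_neg, abs_of_pos hh0] at t2
  rw [← hk, abs_of_pos hk0] at t1
  rw [e1, ← hk, ← hh]
  rw [← hk] at hH2
  rw [← hh] at hH1
  obtain ⟨R1, hR1⟩ : ∃ R, R = U r - U c - U1 c * k - G c * (k^2/2) - g1 c * (k^3/6) := ⟨_, rfl⟩
  obtain ⟨R2, hR2⟩ : ∃ R, R = U l - U c - U1 c * (-h) - G c * ((-h)^2/2) - g1 c * ((-h)^3/6) := ⟨_, rfl⟩
  rw [← hR1] at t1
  rw [← hR2] at t2
  have key : 2 / (h + k) * ((U r - U c) / k - (U c - U l) / h) - G c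
      = g1 c * ((k - h) / 3) + 2 / (h + k) * (R1 / k + R2 / h) := by
    have a1 : U r - U c = U1 c * k + G c * (k^2/2) + g1 c * (k^3/6) + R1 := by rw [hR1]; ring
    have a2 : U c - U l = U1 c * h - G c * (h^2/2) + g1 c * (h^3/6) - R2 := by rw [hR2]; ring
    rw [a1, a2]; field_simp; ring
  rw [key]
  have b1 : |g1 c * ((k - h)/3)| ≤ |g1 c| * |k - h| := by
    rw [abs_mul, abs_div]
    gcongr
    rw [abs_of_pos (by norm_num : (0:ℝ) < 3)]
    linarith [abs_nonneg (k - h)]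
  have b2 : |R1 / k| ≤ B * H^2 * k := by
    rw [abs_div, abs_of_pos hk0, div_le_iff₀ hk0]
    calc |R1| ≤ B * k^4 := t1
      _ = B * k^2 * k * k := by ring
      _ ≤ B * H^2 * k * k := by gcongr
  have b3 : |R2 / h| ≤ B * H^2 * h := by
    rw [abs_div, abs_of_pos hh0, div_le_iff₀ hh0]
    calc |R2| ≤ B * h^4 := t2
      _ = B * h^2 * h * h := by ring
      _ ≤ B * H^2 * h * h := by gcongr
  have b4 : |2 / (h + k) * (R1 / k + R2 / h)| ≤ 2 * B * H^2 := by
    rw [abs_mul, abs_of_pos (by positivity : 0 < 2 / (h + k))]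
    calc 2 / (h+k) * |R1 / k + R2 / h| ≤ 2 / (h+k) * (B * H^2 * k + B * H^2 * h) := by
          gcongr
          exact (abs_add_le _ _).trans (add_le_add b2 b3)
      _ = 2 * B * H^2 := by field_simp; ring
  exact (abs_add_le _ _).trans (add_le_add b1 b4)

lemma trunc2 (U U1 G : ℝ → ℝ) (l c r B : ℝ) (hlc : l < c) (hcr : c < r) (hB : 0 ≤ B)
    (d0 : ∀ y ∈ Icc l r, HasDerivWithinAt U (U1 y) (Icc l r) y)
    (d1 : ∀ y ∈ Icc l r, HasDerivWithinAt U1 (G y) (Icc l r) y)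
    (hb : ∀ y ∈ Icc l r, |G y| ≤ B) :
    |2 / (r - l) * ((U r - U c) / (r - c) - (U c - U l) / (c - l)) - G c| ≤ 3 * B := by
  have s1 : Icc l c ⊆ Icc l r := Icc_subset_Icc le_rfl hcr.le
  have s2 : Icc c r ⊆ Icc l r := Icc_subset_Icc hlc.le le_rfl
  obtain ⟨ξ, hξ, e1⟩ := mvt U U1 l c hlc (fun y hy => (d0 y (s1 hy)).mono s1)
  obtain ⟨η, hη, e2⟩ := mvt U U1 c r hcr (fun y hy => (d0 y (s2 hy)).mono s2)
  have m1 := mvi U1 G l r B (by linarith) d1 hb (s1 (Ioo_subset_Icc_self hξ)) (s2 (Ioo_subset_Icc_self hη))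
  have hc := hb c ⟨hlc.le, hcr.le⟩
  rw [e1, e2, mul_div_cancel_right₀ _ (by linarith : r - c ≠ 0),
    mul_div_cancel_right₀ _ (by linarith : c - l ≠ 0)]
  have hrl : 0 < r - l := by linarith
  have h1 : |η - ξ| ≤ r - l := by
    rw [abs_of_pos (by linarith [hξ.2, hη.1])]; linarith [hξ.1, hη.2]
  have h2 : |2 / (r - l) * (U1 η - U1 ξ)| ≤ 2 * B := by
    rw [abs_mul, abs_of_pos (by positivity : 0 < 2 / (r - l))]
    calc 2 / (r-l) * |U1 η - U1 ξ| ≤ 2 / (r-l) * (B * (r - l)) := by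
          gcongr; exact m1.trans (by gcongr)
      _ = 2 * B := by field_simp
  exact (abs_sub _ _).trans (by linarith)

lemma chord (p p1 p2 : ℝ → ℝ) (l r : ℝ) (hlr : l < r)
    (d0 : ∀ y ∈ Icc l r, HasDerivWithinAt p (p1 y) (Icc l r) y)
    (d1 : ∀ y ∈ Icc l r, HasDerivWithinAt p1 (p2 y) (Icc l r) y)
    (hp : ∀ y ∈ Icc l r, 0 ≤ p2 y) :
    ∀ x ∈ Icc l r, p x ≤ p l + (p r - p l) * (x - l) / (r - l) := by
  intro x hx
  rcases eq_or_lt_of_le hx.1 with h | h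
  · subst h; simp
  rcases eq_or_lt_of_le hx.2 with h' | h'
  · subst h'
    rw [mul_div_cancel_right₀ _ (by linarith)]; linarith
  have s1 : Icc l x ⊆ Icc l r := Icc_subset_Icc le_rfl hx.2
  have s2 : Icc x r ⊆ Icc l r := Icc_subset_Icc hx.1 le_rfl
  obtain ⟨ξ, hξ, e1⟩ := mvt p p1 l x h (fun y hy => (d0 y (s1 hy)).mono s1)
  obtain ⟨η, hη, e2⟩ := mvt p p1 x r h' (fun y hy => (d0 y (s2 hy)).mono s2)
  have s3 : Icc ξ η ⊆ Icc l r := Icc_subset_Icc hξ.1.le hη.2.le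
  obtain ⟨ζ, hζ, e3⟩ := mvt p1 p2 ξ η (by linarith [hξ.2, hη.1]) (fun y hy => (d1 y (s3 hy)).mono s3)
  have h5 : p1 ξ ≤ p1 η := by
    have := mul_nonneg (hp ζ (s3 (Ioo_subset_Icc_self hζ))) (by linarith [hξ.2, hη.1] : 0 ≤ η - ξ)
    linarith
  have h6 : p x - p l ≤ (p r - p l) * (x - l) / (r - l) := by
    rw [le_div_iff₀ (by linarith)]
    have : p r - p l = p1 ξ * (x - l) + p1 η * (r - x) := by linarith
    rw [this, e1]
    nlinarith [mul_nonneg (mul_nonneg (by linarith : 0 ≤ p1 η - p1 ξ) (by linarith : 0 ≤ r - x)) (by linarith : 0 ≤ x - l)]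
  linarith

lemma interpErr (u u1 u2 : ℝ → ℝ) (l r m ε B0 B1 e : ℝ) (hlr : l < r) (hm : 0 < m) (hε : 0 < ε)
    (hB0 : 0 ≤ B0) (hB1 : 0 ≤ B1)
    (d0 : ∀ y ∈ Icc l r, HasDerivWithinAt u (u1 y) (Icc l r) y)
    (d1 : ∀ y ∈ Icc l r, HasDerivWithinAt u1 (u2 y) (Icc l r) y)
    (hb : ∀ y ∈ Icc l r, |u2 y| ≤ B0 + B1 * (EE m ε y / ε^2))
    (hel : EE m ε l ≤ e) (her : EE m ε r ≤ e) :
    ∀ x ∈ Icc l r, |u x - (u l + (u r - u l) * (x - l) / (r - l))| ≤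
      B0 * (r - l)^2 + B1 / m^2 * e := by
  intro x hx
  set Φ : ℝ → ℝ := fun y => B0 * (y^2/2) + B1 / m^2 * EE m ε y with hΦ
  set Φ1 : ℝ → ℝ := fun y => B0 * y + B1 / m^2 * EE1 m ε y with hΦ1
  have dΦ : ∀ y, HasDerivAt Φ (Φ1 y) y := by
    intro y
    have := (((hasDerivAt_id y).pow 2).div_const 2).const_mul B0
    refine (this.add ((EE_d1 m ε y).const_mul (B1/m^2))).congr_deriv ?_
    simp [hΦ1]
  have dΦ1 : ∀ y, HasDerivAt Φ1 (B0 + B1 * (EE m ε y / ε^2)) y := by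
    intro y
    have := (hasDerivAt_id y).const_mul B0
    refine (this.add ((EE_d2 m ε y).const_mul (B1/m^2))).congr_deriv ?_
    field_simp
  have hrl : 0 < r - l := by linarith
  have bΦ : Φ l + (Φ r - Φ l) * (x - l) / (r - l) - Φ x ≤ B0 * (r - l)^2 + B1 / m^2 * e := by
    obtain ⟨w, hw⟩ : ∃ w, w = (x - l) / (r - l) := ⟨_, rfl⟩
    have hw0 : 0 ≤ w := by rw [hw]; exact div_nonneg (by linarith [hx.1]) hrl.le
    have hw1 : w ≤ 1 := by rw [hw, div_le_one hrl]; linarith [hx.2]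
    have hxw : x = l + w * (r - l) := by rw [hw]; field_simp; ring
    rw [mul_div_assoc, ← hw]
    simp only [hΦ]
    have q1 : B0 * (l^2/2) + (B0 * (r^2/2) - B0 * (l^2/2)) * w - B0 * (x^2/2) ≤ B0 * (r-l)^2 := by
      have : B0 * (l^2/2) + (B0 * (r^2/2) - B0 * (l^2/2)) * w - B0 * (x^2/2)
          = B0 * ((w * (1 - w)) / 2 * (r - l)^2) := by rw [hxw]; ring
      rw [this]
      have : (w * (1 - w)) / 2 ≤ 1 := by nlinarith
      have := mul_le_mul_of_nonneg_right this (sq_nonneg (r-l))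
      gcongr
      linarith
    have q2 : (1 - w) * EE m ε l + w * EE m ε r - EE m ε x ≤ e := by
      have := EE_pos m ε x
      nlinarith [mul_le_mul_of_nonneg_left hel (by linarith : 0 ≤ 1 - w),
        mul_le_mul_of_nonneg_left her hw0]
    have q3 : B1 / m^2 * ((1 - w) * EE m ε l + w * EE m ε r - EE m ε x) ≤ B1 / m^2 * e := by gcongr
    linarith
  have c1 := chord (fun y => Φ y - u y) (fun y => Φ1 y - u1 y)
    (fun y => B0 + B1 * (EE m ε y / ε^2) - u2 y) l r hlr
    (fun y hy => (dΦ y).hasDerivWithinAt.sub (d0 y hy))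
    (fun y hy => (dΦ1 y).hasDerivWithinAt.sub (d1 y hy))
    (fun y hy => by have := (abs_le.1 (hb y hy)).2; linarith) x hx
  have c2 := chord (fun y => Φ y + u y) (fun y => Φ1 y + u1 y)
    (fun y => B0 + B1 * (EE m ε y / ε^2) + u2 y) l r hlr
    (fun y hy => (dΦ y).hasDerivWithinAt.add (d0 y hy))
    (fun y hy => (dΦ1 y).hasDerivWithinAt.add (d1 y hy))
    (fun y hy => by have := (abs_le.1 (hb y hy)).1; linarith) x hx
  beta_reduce at c1 c2
  have e1 : (Φ r - u r - (Φ l - u l)) * (x - l) / (r - l)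
    = (Φ r - Φ l) * (x - l) / (r - l) - (u r - u l) * (x - l) / (r - l) := by ring
  have e2 : (Φ r + u r - (Φ l + u l)) * (x - l) / (r - l)
    = (Φ r - Φ l) * (x - l) / (r - l) + (u r - u l) * (x - l) / (r - l) := by ring
  rw [e1] at c1
  rw [e2] at c2
  rw [abs_le]; constructor <;> linarith

/-- the conclusions of `contA` -/
structure SolP (K m ε : ℝ) (u u1 u2 g1 g2 : ℝ → ℝ) : Prop where
  d0 : ∀ x ∈ Icc (0:ℝ) 1, HasDerivWithinAt u (u1 x) (Icc (0:ℝ) 1) x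
  d1 : ∀ x ∈ Icc (0:ℝ) 1, HasDerivWithinAt u1 (u2 x) (Icc (0:ℝ) 1) x
  d2 : ∀ x ∈ Icc (0:ℝ) 1, HasDerivWithinAt (fun x => ε^2*u2 x) (g1 x) (Icc (0:ℝ) 1) x
  d3 : ∀ x ∈ Icc (0:ℝ) 1, HasDerivWithinAt g1 (g2 x) (Icc (0:ℝ) 1) x
  b2 : ∀ x ∈ Icc (0:ℝ) 1, |u2 x| ≤ K*(1+EE m ε x/ε^2)
  b3 : ∀ x ∈ Icc (0:ℝ) 1, |g1 x| ≤ K*(ε+EE m ε x/ε)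
  b4 : ∀ x ∈ Icc (0:ℝ) 1, |g2 x| ≤ K*(1+EE m ε x/ε^2)

lemma EEb (a q κ ε m : ℝ) (ha : 0 < a) (hq : 0 < q) (hm : 0 < m) (lam sf : ℝ → ℝ)
    (M : MeshP a q κ ε lam sf) (r : ℝ) (hr : r ∈ Icc (0:ℝ) 1) :
    EE m ε (lam r) ≤ 48 * Real.exp (m*a) / (m*a*q)^4 * (sf r)^4 := by
  refine (M.exp m hm r hr).trans ?_
  have hs := M.pos r
  have h1 : 0 < m*a*q/sf r := by positivity
  have h2 := Real.pow_div_factorial_le_exp _ h1.le 4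
  have h3 : (Nat.factorial 4 : ℝ) = 24 := by norm_num [Nat.factorial]
  rw [h3] at h2
  rw [Real.exp_neg]
  have h4 : (Real.exp (m*a*q/sf r))⁻¹ ≤ ((m*a*q/sf r)^4/24)⁻¹ := by
    apply inv_anti₀ (by positivity) h2
  calc 2 * Real.exp (m*a) * (Real.exp (m*a*q/sf r))⁻¹
      ≤ 2 * Real.exp (m*a) * ((m*a*q/sf r)^4/24)⁻¹ := by gcongr
    _ = _ := by field_simp; ring

lemma lamMono (a q κ ε : ℝ) (ha : 0 < a) (hq : 0 < q) (hε : 0 < ε) (lam sf : ℝ → ℝ)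
    (M : MeshP a q κ ε lam sf) : StrictMono lam := by
  apply strictMono_of_deriv_pos
  intro x
  rw [(M.d x).deriv]
  have := M.pos x
  positivity

lemma lamMem (a q κ ε : ℝ) (ha : 0 < a) (hq : 0 < q) (hε : 0 < ε) (lam sf : ℝ → ℝ)
    (M : MeshP a q κ ε lam sf) (r : ℝ) (hr : r ∈ Icc (0:ℝ) 1) : lam r ∈ Icc (0:ℝ) 1 := by
  have h := (lamMono a q κ ε ha hq hε lam sf M).monotone
  have h0 := h hr.1
  have h1 := h hr.2
  rw [M.l0] at h0
  rw [M.l1] at h1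
  exact ⟨h0, h1⟩

lemma lamIVT (a q κ ε : ℝ) (lam sf : ℝ → ℝ)
    (M : MeshP a q κ ε lam sf) (r1 r2 y : ℝ) (h : r1 ≤ r2) (hy : y ∈ Icc (lam r1) (lam r2)) :
    ∃ r ∈ Icc r1 r2, lam r = y := by
  have hc : Continuous lam := by
    rw [continuous_iff_continuousAt]
    exact fun t => (M.d t).continuousAt
  exact intermediate_value_Icc h hc.continuousOn hy

lemma lamStep (a q κ ε : ℝ) (ha : 0 < a) (hq : 0 < q) (hε : 0 < ε) (lam sf : ℝ → ℝ)
    (M : MeshP a q κ ε lam sf) (r1 r2 D : ℝ) (h : r1 < r2)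
    (hD : ∀ r ∈ Icc r1 r2, a*ε*q/(sf r)^2 ≤ D) : lam r2 - lam r1 ≤ D * (r2 - r1) := by
  obtain ⟨ξ, hξ, e⟩ := mvt lam (fun t => a*ε*q/(sf t)^2) r1 r2 h
    (fun y _ => (M.d y).hasDerivWithinAt)
  rw [e]
  have := hD ξ (Ioo_subset_Icc_self hξ)
  gcongr

/-- local mesh data near `τ`, coarse case -/
lemma sfI (a q κ ε : ℝ) (lam sf : ℝ → ℝ) (M : MeshP a q κ ε lam sf) (τ δ r : ℝ)
    (hσ : 2*δ ≤ sf τ) (hr : |r - τ| ≤ δ) : sf τ / 2 ≤ sf r ∧ sf r ≤ 3/2 * sf τ := by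
  have := abs_le.1 ((M.lip r τ).trans hr)
  constructor <;> linarith [this.1, this.2]

lemma sfII (a q κ ε : ℝ) (lam sf : ℝ → ℝ) (M : MeshP a q κ ε lam sf) (τ δ r : ℝ)
    (hσ : sf τ < 2*δ) (hr : |r - τ| ≤ δ) : sf r ≤ 3 * δ := by
  have := abs_le.1 ((M.lip r τ).trans hr)
  linarith [this.1, this.2]

lemma derI (a q ε σ s : ℝ) (ha : 0 < a) (hq : 0 < q) (hε : 0 < ε) (hσ : 0 < σ) (hs : σ/2 ≤ s) :
    a*ε*q/s^2 ≤ 4*a*q*ε/σ^2 := by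
  calc a*ε*q/s^2 ≤ a*ε*q/(σ/2)^2 := by gcongr
    _ = _ := by field_simp; ring

lemma derII (a q κ ε s : ℝ) (ha : 0 < a) (hq : 0 < q) (hε : 0 < ε) (hκ : 0 < κ)
    (hs : κ*ε ≤ s^2) : a*ε*q/s^2 ≤ a*q/κ := by
  calc a*ε*q/s^2 ≤ a*ε*q/(κ*ε) := by gcongr
    _ = _ := by field_simp

lemma derDiff (a q ε σ δ s1 s2 : ℝ) (ha : 0 < a) (hq : 0 < q) (hε : 0 < ε) (hσ : 0 < σ)
    (h1 : σ/2 ≤ s1) (h1' : s1 ≤ 3/2*σ) (h2 : σ/2 ≤ s2) (h2' : s2 ≤ 3/2*σ)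
    (hd : |s2 - s1| ≤ 2*δ) :
    |a*ε*q/s1^2 - a*ε*q/s2^2| ≤ 96*a*q*ε*δ/σ^3 := by
  have p1 : 0 < s1 := by linarith
  have p2 : 0 < s2 := by linarith
  have hδ : 0 ≤ δ := by linarith [abs_nonneg (s2 - s1)]
  have e : a*ε*q/s1^2 - a*ε*q/s2^2 = a*ε*q*((s2 - s1)*(s1+s2)/(s1^2*s2^2)) := by
    field_simp; ring
  rw [e, abs_mul (a*ε*q), abs_div, abs_mul (s2 - s1), abs_of_pos (by positivity : 0 < a*ε*q),
    abs_of_pos (by positivity : 0 < s1+s2), abs_of_pos (by positivity : 0 < s1^2*s2^2)]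
  calc a*ε*q*(|s2 - s1| * (s1+s2)/(s1^2*s2^2))
      ≤ a*ε*q*((2*δ)*(3/2*σ+3/2*σ)/((σ/2)^2*(σ/2)^2)) := by gcongr
    _ = _ := by field_simp; ring

lemma epsI (κ ε σ : ℝ) (hκ : 0 < κ) (hε : 0 < ε) (hσ : 0 < σ) (h : κ*ε ≤ σ^2) :
    ε^2/σ^4 ≤ 1/κ^2 := by
  rw [div_le_div_iff₀ (by positivity) (by positivity)]
  have : (κ*ε)^2 ≤ (σ^2)^2 := by gcongr
  nlinarith

lemma bH (a q κ ε σ δ K C5 : ℝ) (hK : 0 < K) (hκ : 0 < κ)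
    (hε : 0 < ε) (hσ : 0 < σ) (h : κ*ε ≤ σ^2) :
    K*(1+6*C5*σ^4/ε^2)*(4*a*q*ε/σ^2*δ)^2 ≤ 16*K*a^2*q^2*(1/κ^2+6*C5)*δ^2 := by
  have e : K*(1+6*C5*σ^4/ε^2)*(4*a*q*ε/σ^2*δ)^2 = 16*K*a^2*q^2*(ε^2/σ^4+6*C5)*δ^2 := by
    field_simp; ring
  rw [e]
  have := epsI κ ε σ hκ hε hσ h
  gcongr

lemma bG (a q κ ε σ δ K C5 : ℝ) (ha : 0 < a) (hq : 0 < q) (hK : 0 < K) (hκ : 0 < κ)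
    (hC5 : 0 < C5) (hε : 0 < ε) (hσ : 0 < σ) (hσ1 : σ ≤ 1) (h : κ*ε ≤ σ^2) :
    K*(ε+C5*σ^4/ε)*(96*a*q*ε*δ/σ^3*δ) ≤ 96*K*a*q*(1/κ^2+C5)*δ^2 := by
  have e : K*(ε+C5*σ^4/ε)*(96*a*q*ε*δ/σ^3*δ) = 96*K*a*q*(ε^2/σ^4*σ+C5*σ)*δ^2 := by
    field_simp
  rw [e]
  have h1 := epsI κ ε σ hκ hε hσ h
  have h2 : ε^2/σ^4*σ ≤ 1/κ^2*1 := by gcongr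
  have h3 : C5*σ ≤ C5*1 := by gcongr
  have h4 : ε^2/σ^4*σ+C5*σ ≤ 1/κ^2+C5 := by linarith
  gcongr

lemma pow4I (C5 s σ : ℝ) (hC5 : 0 < C5) (hs : 0 < s) (h : s ≤ 3/2*σ) : C5*s^4 ≤ 6*C5*σ^4 := by
  have hσ : 0 < σ := by linarith
  calc C5*s^4 ≤ C5*(3/2*σ)^4 := by gcongr
    _ ≤ _ := by nlinarith [show 0 < C5*σ^4 by positivity]

lemma pow4II (C5 s δ : ℝ) (hC5 : 0 < C5) (hs : 0 < s) (h : s ≤ 3*δ) : C5*s^4 ≤ 81*C5*δ^4 := by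
  calc C5*s^4 ≤ C5*(3*δ)^4 := by gcongr
    _ = _ := by ring

lemma interpMesh (a q κ m K C5 : ℝ) (ha : 0 < a) (hq : 0 < q) (hκ : 0 < κ) (hm : 0 < m)
    (hK : 0 < K) (hC5 : C5 = 48 * Real.exp (m*a) / (m*a*q)^4)
    (ε : ℝ) (hε : 0 < ε) (lam sf : ℝ → ℝ) (M : MeshP a q κ ε lam sf)
    (u u1 u2 g1 g2 : ℝ → ℝ) (S : SolP K m ε u u1 u2 g1 g2)
    (τ δ : ℝ) (hδ : 0 < δ) (hδ1 : δ ≤ 1) (h0 : 0 ≤ τ) (h1 : τ + δ ≤ 1) :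
    ∀ x ∈ Icc (lam τ) (lam (τ+δ)),
      |u x - (u (lam τ) + (u (lam (τ+δ)) - u (lam τ)) * (x - lam τ)/(lam (τ+δ) - lam τ))| ≤
      (16*K*a^2*q^2*(1/κ^2+6*C5) + (K*(a*q/κ)^2 + K/m^2*(81*C5))) * δ^2 := by
  have hC5p : 0 < C5 := by rw [hC5]; positivity
  have hmono := lamMono a q κ ε ha hq hε lam sf M
  have hlt : lam τ < lam (τ+δ) := hmono (by linarith)
  have hsub : Icc (lam τ) (lam (τ+δ)) ⊆ Icc 0 1 :=
    Icc_subset_Icc (lamMem a q κ ε ha hq hε lam sf M τ ⟨h0, by linarith⟩).1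
      (lamMem a q κ ε ha hq hε lam sf M (τ+δ) ⟨by linarith, h1⟩).2
  have d0 : ∀ y ∈ Icc (lam τ) (lam (τ+δ)), HasDerivWithinAt u (u1 y) (Icc (lam τ) (lam (τ+δ))) y :=
    fun y hy => (S.d0 y (hsub hy)).mono hsub
  have d1 : ∀ y ∈ Icc (lam τ) (lam (τ+δ)), HasDerivWithinAt u1 (u2 y) (Icc (lam τ) (lam (τ+δ))) y :=
    fun y hy => (S.d1 y (hsub hy)).mono hsub
  have hE : ∀ r ∈ Icc τ (τ+δ), EE m ε (lam r) ≤ C5 * (sf r)^4 := by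
    intro r hr
    rw [hC5]
    exact EEb a q κ ε m ha hq hm lam sf M r ⟨by linarith [hr.1], by linarith [hr.2]⟩
  have habs : ∀ r ∈ Icc τ (τ+δ), |r - τ| ≤ δ := by
    intro r hr
    rw [abs_le]; constructor <;> linarith [hr.1, hr.2]
  have hτm : τ ∈ Icc τ (τ+δ) := ⟨le_rfl, by linarith⟩
  have hτm' : τ+δ ∈ Icc τ (τ+δ) := ⟨by linarith, le_rfl⟩
  have hσ := M.pos τ
  have hlow := M.low τ
  have hA : 0 < 16*K*a^2*q^2*(1/κ^2+6*C5) := by positivity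
  have hBp : 0 < K*(a*q/κ)^2 + K/m^2*(81*C5) := by positivity
  intro x hx
  rcases le_or_gt (2*δ) (sf τ) with hc | hc
  · have hE' : ∀ r ∈ Icc τ (τ+δ), EE m ε (lam r) ≤ 6*C5 * (sf τ)^4 := fun r hr =>
      (hE r hr).trans (pow4I C5 _ _ hC5p (M.pos r) (sfI a q κ ε lam sf M τ δ r hc (habs r hr)).2)
    have hst := lamStep a q κ ε ha hq hε lam sf M τ (τ+δ) (4*a*q*ε/(sf τ)^2) (by linarith)
      (fun r hr => derI a q ε _ _ ha hq hε hσ (sfI a q κ ε lam sf M τ δ r hc (habs r hr)).1)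
    rw [add_sub_cancel_left] at hst
    have := interpErr u u1 u2 (lam τ) (lam (τ+δ)) m ε (K*(1+6*C5*(sf τ)^4/ε^2)) 0 (6*C5*(sf τ)^4)
      hlt hm hε (by positivity) le_rfl d0 d1
      (fun y hy => by
        obtain ⟨r, hr, rfl⟩ := lamIVT a q κ ε lam sf M τ (τ+δ) y (by linarith) hy
        refine (S.b2 _ (hsub hy)).trans ?_
        have := hE' r hr
        rw [zero_mul, add_zero]
        gcongr) (hE' _ hτm) (hE' _ hτm') x hx
    refine this.trans ?_
    have h2 := bH a q κ ε (sf τ) δ K C5 hK hκ hε hσ hlow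
    have h3 : K*(1+6*C5*(sf τ)^4/ε^2)*(lam (τ+δ) - lam τ)^2 ≤
        K*(1+6*C5*(sf τ)^4/ε^2)*(4*a*q*ε/(sf τ)^2*δ)^2 := by
      have : 0 ≤ lam (τ+δ) - lam τ := by linarith
      gcongr
    have h4 : 0 < (K*(a*q/κ)^2 + K/m^2*(81*C5))*δ^2 := by positivity
    rw [zero_div, zero_mul, add_zero, add_mul]
    linarith
  · have hE' : ∀ r ∈ Icc τ (τ+δ), EE m ε (lam r) ≤ 81*C5 * δ^4 := fun r hr =>
      (hE r hr).trans (pow4II C5 _ _ hC5p (M.pos r) (sfII a q κ ε lam sf M τ δ r hc (habs r hr)))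
    have hst := lamStep a q κ ε ha hq hε lam sf M τ (τ+δ) (a*q/κ) (by linarith)
      (fun r hr => derII a q κ ε _ ha hq hε hκ (M.low r))
    rw [add_sub_cancel_left] at hst
    have := interpErr u u1 u2 (lam τ) (lam (τ+δ)) m ε K K (81*C5*δ^4)
      hlt hm hε hK.le hK.le d0 d1
      (fun y hy => by
        refine (S.b2 _ (hsub hy)).trans (le_of_eq ?_)
        ring) (hE' _ hτm) (hE' _ hτm') x hx
    refine this.trans ?_
    have h3 : K*(lam (τ+δ) - lam τ)^2 ≤ K*(a*q/κ*δ)^2 := by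
      have : 0 ≤ lam (τ+δ) - lam τ := by linarith
      gcongr
    have h5 : δ^4 ≤ δ^2 := pow_le_pow_of_le_one hδ.le hδ1 (by norm_num)
    have h6 : K/m^2*(81*C5*δ^4) ≤ K/m^2*(81*C5*δ^2) := by gcongr
    have h4 : 0 < (16*K*a^2*q^2*(1/κ^2+6*C5))*δ^2 := by positivity
    have e1 : (16*K*a^2*q^2*(1/κ^2+6*C5) + (K*(a*q/κ)^2 + K/m^2*(81*C5))) * δ^2 =
      (16*K*a^2*q^2*(1/κ^2+6*C5))*δ^2 + K*(a*q/κ*δ)^2 + K/m^2*(81*C5*δ^2) := by ring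
    rw [e1]
    linarith

lemma truncMesh (a q κ m K C5 : ℝ) (ha : 0 < a) (hq : 0 < q) (hκ : 0 < κ) (hm : 0 < m)
    (hK : 0 < K) (hC5 : C5 = 48 * Real.exp (m*a) / (m*a*q)^4)
    (ε : ℝ) (hε : 0 < ε) (lam sf : ℝ → ℝ) (M : MeshP a q κ ε lam sf)
    (u u1 u2 g1 g2 : ℝ → ℝ) (S : SolP K m ε u u1 u2 g1 g2)
    (τ δ : ℝ) (hδ : 0 < δ) (hδ1 : δ ≤ 1) (h0 : 0 ≤ τ - δ) (h1 : τ + δ ≤ 1) :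
    |ε^2*(2/(lam (τ+δ) - lam (τ-δ)) * ((u (lam (τ+δ)) - u (lam τ))/(lam (τ+δ) - lam τ)
        - (u (lam τ) - u (lam (τ-δ)))/(lam τ - lam (τ-δ)))) - ε^2*u2 (lam τ)| ≤
      (96*K*a*q*(1/κ^2+C5) + 2*(16*K*a^2*q^2*(1/κ^2+6*C5)) + 3*(K*(81/κ^2+81*C5))) * δ^2 := by
  have hC5p : 0 < C5 := by rw [hC5]; positivity
  have hmono := lamMono a q κ ε ha hq hε lam sf M
  have hlt : lam τ < lam (τ+δ) := hmono (by linarith)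
  have hlt' : lam (τ-δ) < lam τ := hmono (by linarith)
  have hsub : Icc (lam (τ-δ)) (lam (τ+δ)) ⊆ Icc 0 1 :=
    Icc_subset_Icc (lamMem a q κ ε ha hq hε lam sf M (τ-δ) ⟨h0, by linarith⟩).1
      (lamMem a q κ ε ha hq hε lam sf M (τ+δ) ⟨by linarith, h1⟩).2
  have d0 : ∀ y ∈ Icc (lam (τ-δ)) (lam (τ+δ)), HasDerivWithinAt (fun x => ε^2*u x) (ε^2*u1 y)
      (Icc (lam (τ-δ)) (lam (τ+δ))) y :=
    fun y hy => ((S.d0 y (hsub hy)).mono hsub).const_mul _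
  have d1 : ∀ y ∈ Icc (lam (τ-δ)) (lam (τ+δ)), HasDerivWithinAt (fun x => ε^2*u1 x) (ε^2*u2 y)
      (Icc (lam (τ-δ)) (lam (τ+δ))) y :=
    fun y hy => ((S.d1 y (hsub hy)).mono hsub).const_mul _
  have hE : ∀ r ∈ Icc (τ-δ) (τ+δ), EE m ε (lam r) ≤ C5 * (sf r)^4 := by
    intro r hr
    rw [hC5]
    exact EEb a q κ ε m ha hq hm lam sf M r ⟨by linarith [hr.1], by linarith [hr.2]⟩
  have habs : ∀ r ∈ Icc (τ-δ) (τ+δ), |r - τ| ≤ δ := by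
    intro r hr
    rw [abs_le]; constructor <;> linarith [hr.1, hr.2]
  have hτm : τ ∈ Icc (τ-δ) (τ+δ) := ⟨by linarith, by linarith⟩
  have hσ := M.pos τ
  have hlow := M.low τ
  have hcm : lam τ ∈ Icc (lam (τ-δ)) (lam (τ+δ)) := ⟨hlt'.le, hlt.le⟩
  have e0 : ε^2*(2/(lam (τ+δ) - lam (τ-δ)) * ((u (lam (τ+δ)) - u (lam τ))/(lam (τ+δ) - lam τ)
        - (u (lam τ) - u (lam (τ-δ)))/(lam τ - lam (τ-δ)))) =
      2/(lam (τ+δ) - lam (τ-δ)) * ((ε^2*u (lam (τ+δ)) - ε^2*u (lam τ))/(lam (τ+δ) - lam τ)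
        - (ε^2*u (lam τ) - ε^2*u (lam (τ-δ)))/(lam τ - lam (τ-δ))) := by ring
  rw [e0]
  rcases le_or_gt (2*δ) (sf τ) with hc | hc
  · have hE' : ∀ r ∈ Icc (τ-δ) (τ+δ), EE m ε (lam r) ≤ 6*C5 * (sf τ)^4 := fun r hr =>
      (hE r hr).trans (pow4I C5 _ _ hC5p (M.pos r) (sfI a q κ ε lam sf M τ δ r hc (habs r hr)).2)
    have hst := lamStep a q κ ε ha hq hε lam sf M τ (τ+δ) (4*a*q*ε/(sf τ)^2) (by linarith)
      (fun r hr => derI a q ε _ _ ha hq hε hσ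
        (sfI a q κ ε lam sf M τ δ r hc (habs r ⟨by linarith [hr.1], hr.2⟩)).1)
    have hst' := lamStep a q κ ε ha hq hε lam sf M (τ-δ) τ (4*a*q*ε/(sf τ)^2) (by linarith)
      (fun r hr => derI a q ε _ _ ha hq hε hσ
        (sfI a q κ ε lam sf M τ δ r hc (habs r ⟨hr.1, by linarith [hr.2]⟩)).1)
    rw [add_sub_cancel_left] at hst
    rw [sub_sub_cancel] at hst'
    have hdiff : |(lam (τ+δ) - lam τ) - (lam τ - lam (τ-δ))| ≤ 96*a*q*ε*δ/(sf τ)^3*δ := by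
      obtain ⟨ξ, hξ, e1⟩ := mvt lam (fun t => a*ε*q/(sf t)^2) τ (τ+δ) (by linarith)
        (fun y _ => (M.d y).hasDerivWithinAt)
      obtain ⟨η, hη, e2⟩ := mvt lam (fun t => a*ε*q/(sf t)^2) (τ-δ) τ (by linarith)
        (fun y _ => (M.d y).hasDerivWithinAt)
      rw [e1, e2]
      have s1 := sfI a q κ ε lam sf M τ δ ξ hc (habs ξ ⟨by linarith [hξ.1], by linarith [hξ.2]⟩)
      have s2 := sfI a q κ ε lam sf M τ δ η hc (habs η ⟨by linarith [hη.1], by linarith [hη.2]⟩)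
      have h3 : |sf η - sf ξ| ≤ 2*δ := by
        refine (M.lip η ξ).trans ?_
        rw [abs_le]; constructor <;> linarith [hξ.1, hξ.2, hη.1, hη.2]
      have h4 := derDiff a q ε (sf τ) δ (sf ξ) (sf η) ha hq hε hσ s1.1 s1.2 s2.1 s2.2 h3
      rw [add_sub_cancel_left, sub_sub_cancel, ← sub_mul, abs_mul, abs_of_pos hδ]
      gcongr
    have := trunc1 (fun x => ε^2*u x) (fun x => ε^2*u1 x) (fun x => ε^2*u2 x) g1 g2
      (lam (τ-δ)) (lam τ) (lam (τ+δ)) (K*(1+6*C5*(sf τ)^4/ε^2)) (4*a*q*ε/(sf τ)^2*δ)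
      hlt' hlt (by positivity) d0 d1
      (fun y hy => (S.d2 y (hsub hy)).mono hsub) (fun y hy => (S.d3 y (hsub hy)).mono hsub)
      (fun y hy => by
        obtain ⟨r, hr, rfl⟩ := lamIVT a q κ ε lam sf M (τ-δ) (τ+δ) y (by linarith) hy
        refine (S.b4 _ (hsub hy)).trans ?_
        have := hE' r hr
        gcongr) hst' hst
    refine this.trans ?_
    have h2 := bH a q κ ε (sf τ) δ K C5 hK hκ hε hσ hlow
    have h3 := bG a q κ ε (sf τ) δ K C5 ha hq hK hκ hC5p hε hσ
      (M.le τ ⟨by linarith, by linarith⟩) hlow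
    have h5 : |g1 (lam τ)| ≤ K*(ε+C5*(sf τ)^4/ε) := by
      refine (S.b3 _ (hsub hcm)).trans ?_
      have := hE τ hτm
      gcongr
    have h6 : |g1 (lam τ)| * |(lam (τ+δ) - lam τ) - (lam τ - lam (τ-δ))| ≤
        K*(ε+C5*(sf τ)^4/ε)*(96*a*q*ε*δ/(sf τ)^3*δ) := by gcongr
    have h4 : 0 < (3*(K*(81/κ^2+81*C5)))*δ^2 := by positivity
    rw [add_mul, add_mul]
    linarith
  · have hE' : ∀ r ∈ Icc (τ-δ) (τ+δ), EE m ε (lam r) ≤ 81*C5 * δ^4 := fun r hr =>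
      (hE r hr).trans (pow4II C5 _ _ hC5p (M.pos r) (sfII a q κ ε lam sf M τ δ r hc (habs r hr)))
    have h5 : δ^4 ≤ δ^2 := pow_le_pow_of_le_one hδ.le hδ1 (by norm_num)
    have hε2 : ε^2 ≤ 81/κ^2*δ^4 := by
      have : κ*ε ≤ (3*δ)^2 := hlow.trans (by
        have := sfII a q κ ε lam sf M τ δ τ hc (habs τ hτm)
        gcongr)
      have h7 : (κ*ε)^2 ≤ ((3*δ)^2)^2 := by gcongr
      rw [div_mul_eq_mul_div, le_div_iff₀ (by positivity)]
      nlinarith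
    have := trunc2 (fun x => ε^2*u x) (fun x => ε^2*u1 x) (fun x => ε^2*u2 x)
      (lam (τ-δ)) (lam τ) (lam (τ+δ)) (K*(81/κ^2+81*C5)*δ^2)
      hlt' hlt (by positivity) d0 d1
      (fun y hy => by
        obtain ⟨r, hr, rfl⟩ := lamIVT a q κ ε lam sf M (τ-δ) (τ+δ) y (by linarith) hy
        have b := S.b2 _ (hsub hy)
        have e := hE' r hr
        rw [abs_mul, abs_of_pos (by positivity : 0 < ε^2)]
        calc ε^2*|u2 (lam r)| ≤ ε^2*(K*(1+EE m ε (lam r)/ε^2)) := by gcongr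
          _ = K*(ε^2 + EE m ε (lam r)) := by field_simp
          _ ≤ K*(81/κ^2*δ^4 + 81*C5*δ^4) := by gcongr
          _ = K*(81/κ^2+81*C5)*δ^4 := by ring
          _ ≤ _ := by gcongr)
    refine this.trans ?_
    have h4 : 0 < (96*K*a*q*(1/κ^2+C5))*δ^2 := by positivity
    have h6 : 0 < (2*(16*K*a^2*q^2*(1/κ^2+6*C5)))*δ^2 := by positivity
    rw [add_mul, add_mul]
    linarith

lemma discMax (ε c R : ℝ) (hc : 0 < c) (hR : 0 ≤ R) (n : ℕ) (x e b r : ℕ → ℝ)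
    (hx : ∀ i < n, x i < x (i+1)) (h0 : e 0 = 0) (hn : e n = 0)
    (heq : ∀ i, 1 ≤ i → i < n → -ε^2 * ddiff x e i + b i * e i = r i)
    (hb : ∀ i, 1 ≤ i → i < n → c^2 ≤ b i) (hr : ∀ i, 1 ≤ i → i < n → r i ≤ R) :
    ∀ i ≤ n, e i ≤ R/c^2 := by
  obtain ⟨j, hj, hmax⟩ := (Finset.range (n+1)).exists_max_image e ⟨0, by simp⟩
  have hmax' : ∀ i ≤ n, e i ≤ e j := fun i hi => hmax i (Finset.mem_range.2 (by omega))
  have hjn : j ≤ n := by have := Finset.mem_range.1 hj; omega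
  intro i hi
  refine (hmax' i hi).trans ?_
  have hRc : 0 ≤ R/c^2 := by positivity
  rcases Nat.eq_zero_or_pos j with h | h
  · rw [h, h0]; exact hRc
  rcases eq_or_lt_of_le hjn with h' | h'
  · rw [h', hn]; exact hRc
  by_contra hcon
  push Not at hcon
  have hpos : 0 < e j := lt_of_le_of_lt hRc hcon
  have hE := heq j h h'
  have hd : ddiff x e j ≤ 0 := by
    unfold ddiff
    have x1 := hx j h'
    have x2 := hx (j-1) (by omega)
    have hj1 : j - 1 + 1 = j := by omega
    rw [hj1] at x2
    have a1 : (e (j+1) - e j) / (x (j+1) - x j) ≤ 0 :=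
      div_nonpos_of_nonpos_of_nonneg (by linarith [hmax' (j+1) (by omega)]) (by linarith)
    have a2 : 0 ≤ (e j - e (j-1)) / (x j - x (j-1)) :=
      div_nonneg (by linarith [hmax' (j-1) (by omega)]) (by linarith)
    apply mul_nonpos_of_nonneg_of_nonpos
    · apply div_nonneg (by norm_num); linarith
    · linarith
  have h1 : 0 ≤ -ε^2 * ddiff x e j := by nlinarith [sq_nonneg ε]
  have h2 : c^2 * e j ≤ b j * e j := by
    have := hb j h h'
    gcongr
  have h3 := hr j h h'
  have h4 : R < e j * c^2 := by rwa [div_lt_iff₀ (by positivity)] at hcon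
  linarith

lemma ddiff_neg (x e : ℕ → ℝ) (i : ℕ) : ddiff x (fun i => - e i) i = - ddiff x e i := by
  unfold ddiff; ring

lemma ddiff_sub (x e g : ℕ → ℝ) (i : ℕ) :
    ddiff x (fun i => e i - g i) i = ddiff x e i - ddiff x g i := by
  unfold ddiff; ring

lemma discStab (ε c R : ℝ) (hc : 0 < c) (hR : 0 ≤ R) (n : ℕ) (x e b r : ℕ → ℝ)
    (hx : ∀ i < n, x i < x (i+1)) (h0 : e 0 = 0) (hn : e n = 0)
    (heq : ∀ i, 1 ≤ i → i < n → -ε^2 * ddiff x e i + b i * e i = r i)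
    (hb : ∀ i, 1 ≤ i → i < n → c^2 ≤ b i) (hr : ∀ i, 1 ≤ i → i < n → |r i| ≤ R) :
    ∀ i ≤ n, |e i| ≤ R/c^2 := by
  intro i hi
  have p := discMax ε c R hc hR n x e b r hx h0 hn heq hb
    (fun i h h' => (le_abs_self _).trans (hr i h h')) i hi
  have m := discMax ε c R hc hR n x (fun i => - e i) b (fun i => - r i) hx (by simp [h0])
    (by simp [hn]) (fun i h h' => by rw [ddiff_neg]; linarith [heq i h h']) hb
    (fun i h h' => (neg_le_abs _).trans (hr i h h')) i hi
  exact abs_le.2 ⟨by linarith, p⟩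

lemma locate (n : ℕ) (x : ℕ → ℝ) (hn : 1 ≤ n) (t : ℝ) (h0 : x 0 ≤ t) (h1 : t ≤ x n) :
    ∃ i < n, t ∈ Icc (x i) (x (i+1)) := by
  induction n with
  | zero => omega
  | succ k ih =>
    rcases le_or_gt (x k) t with h | h
    · exact ⟨k, by omega, h, h1⟩
    · rcases Nat.eq_zero_or_pos k with hk | hk
      · rw [hk] at h; linarith
      · obtain ⟨i, hi, hm⟩ := ih hk h.le
        exact ⟨i, by omega, hm⟩

lemma convComb (y0 y1 v0 v1 l r t Q : ℝ) (hlr : l < r) (ht : t ∈ Icc l r)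
    (h0 : |y0 - v0| ≤ Q) (h1 : |y1 - v1| ≤ Q) :
    |(y0 + (y1 - y0)*(t-l)/(r-l)) - (v0 + (v1-v0)*(t-l)/(r-l))| ≤ Q := by
  obtain ⟨s, hs⟩ : ∃ s, s = (t-l)/(r-l) := ⟨_, rfl⟩
  have hs0 : 0 ≤ s := by rw [hs]; exact div_nonneg (by linarith [ht.1]) (by linarith)
  have hs1 : s ≤ 1 := by rw [hs, div_le_one (by linarith)]; linarith [ht.2]
  rw [mul_div_assoc, mul_div_assoc, ← hs]
  have e : (y0 + (y1 - y0)*s) - (v0 + (v1-v0)*s) = (1-s)*(y0-v0) + s*(y1-v1) := by ring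
  rw [e]
  rw [abs_le] at *
  constructor <;> nlinarith [h0.1, h0.2, h1.1, h1.2]

/-- interpolant error from nodal error -/
lemma interpTot (n : ℕ) (hn : 1 ≤ n) (x y : ℕ → ℝ) (w u : ℝ → ℝ) (P Q : ℝ)
    (hx : ∀ i < n, x i < x (i+1)) (hw : IsLinInterp x n y w)
    (hnode : ∀ i ≤ n, |y i - u (x i)| ≤ Q)
    (hinterp : ∀ i < n, ∀ t ∈ Icc (x i) (x (i+1)),
      |u t - (u (x i) + (u (x (i+1)) - u (x i)) * (t - x i)/(x (i+1) - x i))| ≤ P)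
    (t : ℝ) (ht : t ∈ Icc (x 0) (x n)) : |w t - u t| ≤ Q + P := by
  obtain ⟨i, hi, hm⟩ := locate n x hn t ht.1 ht.2
  rw [hw.2 i hi t hm]
  have a := convComb (y i) (y (i+1)) (u (x i)) (u (x (i+1))) _ _ t Q (hx i hi) hm
    (hnode i hi.le) (hnode (i+1) hi)
  have b := hinterp i hi t hm
  rw [abs_le] at *
  constructor <;> linarith [a.1, a.2, b.1, b.2]

lemma meshTot (f : ℝ → ℝ → ℝ) (c₀ : ℝ) (hc₀ : 0 < c₀) (hf : SmoothF f) (hfu : LowerF f c₀)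
    (q a : ℝ) (hq : q ∈ Ioo (0:ℝ) (1/2)) (ha : 0 < a) :
    ∃ K CT CI : ℝ, 0 < K ∧ 0 < CT ∧ 0 < CI ∧ ∀ ε ∈ Ioc (0:ℝ) 1, a * ε < q →
      ∀ u : ℝ → ℝ, IsSolution f ε u → (∀ t ∈ Icc (0:ℝ) 1, |u t| ≤ K) ∧
      ∀ n : ℕ, 1 ≤ n →
        vulMesh a ε q n 0 = 0 ∧ vulMesh a ε q n n = 1 ∧
        (∀ i ≤ n, vulMesh a ε q n i ∈ Icc (0:ℝ) 1) ∧
        (∀ i < n, vulMesh a ε q n i < vulMesh a ε q n (i+1)) ∧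
        (∀ i, 1 ≤ i → i < n →
          |ε^2 * ddiff (vulMesh a ε q n) (fun i => u (vulMesh a ε q n i)) i
            - f (vulMesh a ε q n i) (u (vulMesh a ε q n i))| ≤ CT * (1/(n:ℝ))^2) ∧
        (∀ i < n, ∀ t ∈ Icc (vulMesh a ε q n i) (vulMesh a ε q n (i+1)),
          |u t - (u (vulMesh a ε q n i) + (u (vulMesh a ε q n (i+1)) - u (vulMesh a ε q n i))
            * (t - vulMesh a ε q n i)/(vulMesh a ε q n (i+1) - vulMesh a ε q n i))|
            ≤ CI * (1/(n:ℝ))^2) := by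
  obtain ⟨K, hK, hA⟩ := contA f c₀ hc₀ hf hfu
  obtain ⟨hq0, hq1⟩ := hq
  obtain ⟨κ, hκd⟩ : ∃ κ, κ = a*q*(1-2*q)/(1+2*q)^2 := ⟨_, rfl⟩
  have h12 : 0 < 1 - 2*q := by linarith
  have hκ : 0 < κ := by rw [hκd]; positivity
  obtain ⟨m, hm⟩ : ∃ m, m = c₀/2 := ⟨_, rfl⟩
  have hm0 : 0 < m := by rw [hm]; positivity
  obtain ⟨C5, hC5⟩ : ∃ C5, C5 = 48 * Real.exp (m*a) / (m*a*q)^4 := ⟨_, rfl⟩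
  have hC5p : 0 < C5 := by rw [hC5]; positivity
  refine ⟨K, 96*K*a*q*(1/κ^2+C5) + 2*(16*K*a^2*q^2*(1/κ^2+6*C5)) + 3*(K*(81/κ^2+81*C5)),
    16*K*a^2*q^2*(1/κ^2+6*C5) + (K*(a*q/κ)^2 + K/m^2*(81*C5)), hK, ?_, ?_, fun ε hε haq u hu => ?_⟩
  rotate_left 2
  · have M := vulMeshP a q ε hq0 hq1 ha hε.1 haq
    rw [← hκd] at M
    obtain ⟨u1, u2, g1, g2, hS⟩ := hA ε hε.1 hε.2 u hu
    rw [← hm] at hS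
    have S : SolP K m ε u u1 u2 g1 g2 :=
      ⟨fun x hx => (hS x hx).1, fun x hx => (hS x hx).2.1, fun x hx => (hS x hx).2.2.1,
        fun x hx => (hS x hx).2.2.2.1, fun x hx => (hS x hx).2.2.2.2.2.2.1,
        fun x hx => (hS x hx).2.2.2.2.2.2.2.1, fun x hx => (hS x hx).2.2.2.2.2.2.2.2⟩
    refine ⟨fun t ht => (hS t ht).2.2.2.2.2.1, fun n hn => ?_⟩
    have hn0 : (0:ℝ) < n := by exact_mod_cast hn
    have hδ : (0:ℝ) < 1/n := by positivity
    have hδ1 : (1:ℝ)/n ≤ 1 := by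
      rw [div_le_one hn0]; exact_mod_cast hn
    have hmono := lamMono a q κ ε ha hq0 hε.1 _ _ M
    have hin : ∀ i ≤ n, (i:ℝ)/n ∈ Icc (0:ℝ) 1 := fun i hi =>
      ⟨by positivity, by rw [div_le_one hn0]; exact_mod_cast hi⟩
    have hsucc : ∀ i : ℕ, ((i+1 : ℕ):ℝ)/n = (i:ℝ)/n + 1/n := fun i => by push_cast; ring
    have hpred : ∀ i : ℕ, 1 ≤ i → ((i-1 : ℕ):ℝ)/n = (i:ℝ)/n - 1/n := fun i hi => by
      rw [Nat.cast_sub hi]; push_cast; ring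
    have hmem : ∀ i ≤ n, vulMesh a ε q n i ∈ Icc (0:ℝ) 1 := fun i hi =>
      lamMem a q κ ε ha hq0 hε.1 _ _ M _ (hin i hi)
    refine ⟨?_, ?_, hmem, ?_, ?_, ?_⟩
    · unfold vulMesh
      rw [Nat.cast_zero, zero_div, M.l0]
    · unfold vulMesh
      rw [div_self hn0.ne', M.l1]
    · intro i hi
      unfold vulMesh
      rw [hsucc]
      exact hmono (by linarith)
    · intro i hi hin'
      rw [← (hS _ (hmem i hin'.le)).2.2.2.2.1]
      unfold ddiff vulMesh
      beta_reduce
      rw [hsucc, hpred i hi]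
      have h1 := hin (i+1) hin'
      have h2 := hin (i-1) (by omega)
      rw [hsucc] at h1
      rw [hpred i hi] at h2
      exact truncMesh a q κ m K C5 ha hq0 hκ hm0 hK hC5 ε hε.1 _ _ M u u1 u2 g1 g2 S
        ((i:ℝ)/n) (1/n) hδ hδ1 h2.1 h1.2
    · intro i hi
      unfold vulMesh
      rw [hsucc]
      have h1 := hin (i+1) hi
      have h2 := hin i hi.le
      rw [hsucc] at h1
      exact interpMesh a q κ m K C5 ha hq0 hκ hm0 hK hC5 ε hε.1 _ _ M u u1 u2 g1 g2 S
        ((i:ℝ)/n) (1/n) hδ hδ1 h2.1 h1.2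
  · positivity
  · positivity

/-- error estimate of the two-grid algorithm on the Vulanović
mesh, with fine mesh `n = N²`. -/
theorem stmt_19 (f : ℝ → ℝ → ℝ) (c₀ : ℝ) (hc₀ : 0 < c₀)
    (hf : SmoothF f) (hfu : LowerF f c₀)
    (q a : ℝ) (hq : q ∈ Ioo (0:ℝ) (1/2)) (ha : 0 < a)
    (hac : 2 ≤ a * c₀) :
    ∃ N₀ : ℕ, ∃ C : ℝ, 0 < C ∧
      ∀ ε ∈ Ioc (0:ℝ) 1, a * ε < q → ∀ N : ℕ, N₀ ≤ N →
      ∀ u : ℝ → ℝ, IsSolution f ε u →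
      ∀ yH : ℕ → ℝ, NonlinScheme f ε (vulMesh a ε q N) N yH →
      ∀ yint : ℝ → ℝ, IsLinInterp (vulMesh a ε q N) N yH yint →
      ∀ yh : ℕ → ℝ,
        LinScheme (fun t => pderiv1 f t (yint t))
          (fun t => pderiv1 f t (yint t) * yint t - f t (yint t)) ε
          (vulMesh a ε q (N ^ 2)) (N ^ 2) yh →
      ∀ uI : ℝ → ℝ,
        IsLinInterp (vulMesh a ε q (N ^ 2)) (N ^ 2) yh uI →
        ∀ x ∈ Icc (0:ℝ) 1,
          |uI x - u x| ≤ C * ((N:ℝ) ^ 4)⁻¹ := by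
  obtain ⟨K, CT, CI, hK, hCT, hCI, H⟩ := meshTot f c₀ hc₀ hf hfu q a hq ha
  obtain ⟨fx, fu, cfx, cfu, dxf, duf⟩ := chainF f 3 hf
  obtain ⟨fux, fuu, cfux, cfuu, dxfu, dufu⟩ := chainF fu 2 cfu
  have hp : ∀ x ∈ Icc (0:ℝ) 1, ∀ y, pderiv1 f x y = fu x y := fun x hx y => (duf x hx y).deriv
  have hfuL : ∀ x ∈ Icc (0:ℝ) 1, ∀ y, c₀^2 ≤ fu x y := by
    intro x hx y
    have := hfu x hx y
    rwa [hp x hx y] at this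
  obtain ⟨D1, hD1⟩ : ∃ z : ℝ, z = CT/c₀^2 + CI := ⟨_, rfl⟩
  have hD1p : 0 < D1 := by rw [hD1]; positivity
  obtain ⟨M2, hM2, bM2⟩ := bddF fuu cfuu.continuousOn (K + D1)
  refine ⟨1, (CT + M2*D1^2)/c₀^2 + CI, by positivity, ?_⟩
  intro ε hε haq N hN u hu yH hyH yint hyint yh hyh uI huI x hx
  obtain ⟨hub, Hn⟩ := H ε hε haq u hu
  have hN0 : (0:ℝ) < N := by exact_mod_cast hN
  have hNi : (1:ℝ)/N ≤ 1 := by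
    rw [div_le_one hN0]; exact_mod_cast hN
  have hNi0 : (0:ℝ) < 1/N := by positivity
  -- coarse mesh
  obtain ⟨x0, xN, xm, xlt, xT, xI⟩ := Hn N hN
  have hcoarse : ∀ t ∈ Icc (0:ℝ) 1, |yint t - u t| ≤ D1 * (1/(N:ℝ))^2 := by
    have hex : ∀ i : ℕ, ∃ b : ℝ, 1 ≤ i → i < N → c₀^2 ≤ b ∧
        f (vulMesh a ε q N i) (yH i) - f (vulMesh a ε q N i) (u (vulMesh a ε q N i)) =
          b * (yH i - u (vulMesh a ε q N i)) := by
      intro i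
      by_cases hi : i ≤ N
      · obtain ⟨ξ, -, -, h⟩ := meanF f fu _ (duf _ (xm i hi)) (yH i) (u (vulMesh a ε q N i))
        exact ⟨_, fun _ _ => ⟨hfuL _ (xm i hi) ξ, h⟩⟩
      · exact ⟨0, fun _ h => absurd h.le hi⟩
    choose b hb using hex
    have hnode := discStab ε c₀ (CT * (1/(N:ℝ))^2) hc₀ (by positivity) N (vulMesh a ε q N)
      (fun i => yH i - u (vulMesh a ε q N i)) b
      (fun i => ε^2 * ddiff (vulMesh a ε q N) (fun i => u (vulMesh a ε q N i)) i
            - f (vulMesh a ε q N i) (u (vulMesh a ε q N i))) xlt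
      (by simp only [x0, hyH.2.1, hu.2.2.1, sub_zero]) (by simp only [xN, hyH.2.2, hu.2.2.2, sub_zero])
      (fun i h h' => by
        rw [ddiff_sub]
        have e1 := hyH.1 i h h'
        have e2 := (hb i h h').2
        linarith) (fun i h h' => (hb i h h').1) xT
    intro t ht
    have := interpTot N hN (vulMesh a ε q N) yH yint u _ _ xlt hyint hnode xI t
      (by rw [x0, xN]; exact ht)
    refine this.trans (le_of_eq ?_)
    rw [hD1]; ring
  -- fine mesh
  have hn : 1 ≤ N^2 := Nat.one_le_pow _ _ hN
  obtain ⟨z0, zN, zm, zlt, zT, zI⟩ := Hn (N^2) hn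
  have hnode := discStab ε c₀ (CT * (1/((N^2:ℕ):ℝ))^2 + M2*(D1 * (1/(N:ℝ))^2)^2) hc₀
    (by positivity) (N^2) (vulMesh a ε q (N^2))
    (fun i => yh i - u (vulMesh a ε q (N^2) i))
    (fun i => pderiv1 f (vulMesh a ε q (N^2) i) (yint (vulMesh a ε q (N^2) i)))
    (fun i => (ε^2 * ddiff (vulMesh a ε q (N^2)) (fun i => u (vulMesh a ε q (N^2) i)) i
            - f (vulMesh a ε q (N^2) i) (u (vulMesh a ε q (N^2) i)))
          + (f (vulMesh a ε q (N^2) i) (u (vulMesh a ε q (N^2) i))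
            - f (vulMesh a ε q (N^2) i) (yint (vulMesh a ε q (N^2) i))
            - pderiv1 f (vulMesh a ε q (N^2) i) (yint (vulMesh a ε q (N^2) i))
              * (u (vulMesh a ε q (N^2) i) - yint (vulMesh a ε q (N^2) i)))) zlt
      (by simp only [z0, hyh.2.1, hu.2.2.1, sub_zero]) (by simp only [zN, hyh.2.2, hu.2.2.2, sub_zero])
      (fun i h h' => by
        rw [ddiff_sub]
        have e1 := hyh.1 i h h'
        beta_reduce at e1
        linarith)
      (fun i h h' => hfu _ (zm i h'.le) _)
      (fun i h h' => by
        refine (abs_add_le _ _).trans (add_le_add (zT i h h') ?_)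
        have zi := zm i h'.le
        generalize vulMesh a ε q (N^2) i = s at zi
        rw [hp s zi]
        have hc := hcoarse s zi
        have hc' : |u s - yint s| ≤ D1 * (1/(N:ℝ))^2 := by rwa [abs_sub_comm]
        have hus := hub s zi
        have hD : D1 * (1/(N:ℝ))^2 ≤ D1 := by
          have : (1/(N:ℝ))^2 ≤ 1 := pow_le_one₀ hNi0.le hNi
          nlinarith
        have hys : |yint s| ≤ K + D1 := by
          have := abs_add_le (yint s - u s) (u s)
          rw [sub_add_cancel] at this
          linarith
        obtain ⟨ξ, h1, h2, h3⟩ := meanF f fu s (duf s zi) (u s) (yint s)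
        obtain ⟨η, -, h5, h6⟩ := meanF fu fuu s (dufu s zi) ξ (yint s)
        have hξ : |ξ| ≤ K + D1 := h2.trans (max_le (by linarith) hys)
        have hη : |η| ≤ K + D1 := h5.trans (max_le hξ hys)
        have hm := bM2 s zi η hη
        rw [h3, ← sub_mul, h6, abs_mul, abs_mul]
        calc |fuu s η| * |ξ - yint s| * |u s - yint s|
            ≤ M2 * (D1 * (1/(N:ℝ))^2) * (D1 * (1/(N:ℝ))^2) := by
              have := h1.trans hc'
              gcongr
          _ = _ := by ring)
  have := interpTot (N^2) hn (vulMesh a ε q (N^2)) yh uI u _ _ zlt huI hnode zI x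
      (by rw [z0, zN]; exact hx)
  refine this.trans (le_of_eq ?_)
  push_cast
  field_simp
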